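/- (Memoryless decoders suffice.) In the coordination game with a fully informed adversary, restricting the decoder at Node B to conditional pmfs of the form {p(y_i | j, k)}_{i=1}^n (depending only on the message and the secret key, not on past source symbols or past actions) does not decrease the robust achievable value: the supremum over n and schemes with such restricted decoders of the minimum over adversary strategies of the average value equals Π_{p₀}(R₀,R), the corresponding supremum over all schemes. -/

import Mathlib

open scoped BigOperators Classical

noncomputable section

/-! ### Finite probability basics -/

/-- A probability mass function on a finite type, given as a real-valued function. -/
def IsPMF {α : Type} [Fintype α] (p : α → ℝ) : Prop :=
  (∀ a, 0 ≤ p a) ∧ ∑ a, p a = 1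

/-- The probability that the random variable `A` takes the value `a` under the pmf `p`. -/
def probOf {Ω : Type} {α : Type} [Fintype Ω] (p : Ω → ℝ) (A : Ω → α) (a : α) : ℝ :=
  ∑ ω, if A ω = a then p ω else 0

/-- Shannon entropy (in bits) of the random variable `A` under the pmf `p`. -/
def entropy {Ω α : Type} [Fintype Ω] [Fintype α] (p : Ω → ℝ) (A : Ω → α) : ℝ :=
  -∑ a, probOf p A a * Real.logb 2 (probOf p A a)

/-- Conditional Shannon entropy `H(A | C)` (in bits). -/
def condEntropy {Ω α γ : Type} [Fintype Ω] [Fintype α] [Fintype γ]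
    (p : Ω → ℝ) (A : Ω → α) (C : Ω → γ) : ℝ :=
  entropy p (fun ω => (A ω, C ω)) - entropy p C

/-- Shannon mutual information `I(A;B)` (in bits). -/
def mutualInfo {Ω α β : Type} [Fintype Ω] [Fintype α] [Fintype β]
    (p : Ω → ℝ) (A : Ω → α) (B : Ω → β) : ℝ :=
  entropy p A + entropy p B - entropy p (fun ω => (A ω, B ω))

/-- Conditional Shannon mutual information `I(A;B|C)` (in bits). -/
def condMutualInfo {Ω α β γ : Type} [Fintype Ω] [Fintype α] [Fintype β] [Fintype γ]
    (p : Ω → ℝ) (A : Ω → α) (B : Ω → β) (C : Ω → γ) : ℝ :=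
  entropy p (fun ω => (A ω, C ω)) + entropy p (fun ω => (B ω, C ω))
    - entropy p (fun ω => (A ω, B ω, C ω)) - entropy p C

/-- Conditional independence `A ⟂ B | C` under the pmf `p`:
`P(A=a, B=b, C=c) · P(C=c) = P(A=a, C=c) · P(B=b, C=c)` for all `a, b, c`. -/
def CondIndep {Ω α β γ : Type} [Fintype Ω] (p : Ω → ℝ)
    (A : Ω → α) (B : Ω → β) (C : Ω → γ) : Prop :=
  ∀ a b c,
    probOf p (fun ω => (A ω, B ω, C ω)) (a, b, c) * probOf p C c
      = probOf p (fun ω => (A ω, C ω)) (a, c) * probOf p (fun ω => (B ω, C ω)) (b, c)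

/-! ### Coordination schemes and adversaries -/

/-- Cardinality of the secret-key alphabet: `max 1 ⌊2^{n R₀}⌋`. -/
def keyCard (R0 : ℝ) (n : ℕ) : ℕ := max 1 ⌊(2 : ℝ) ^ ((n : ℝ) * R0)⌋₊

/-- Cardinality of the message alphabet: `max 1 ⌊2^{n R}⌋`. -/
def msgCard (R : ℝ) (n : ℕ) : ℕ := max 1 ⌊(2 : ℝ) ^ ((n : ℝ) * R)⌋₊

/-- An `(R₀, R, n)` coordination scheme: a randomized encoder `p(j | xⁿ, k)` and a
randomized causal decoder `{p(yᵢ | j, k, x^{i-1}, y^{i-1}, z^{i-1})}`. -/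
structure Scheme (X Y Z : Type) [Fintype X] [Fintype Y] [Fintype Z]
    (R0 R : ℝ) (n : ℕ) where
  enc : (Fin n → X) → Fin (keyCard R0 n) → Fin (msgCard R n) → ℝ
  enc_pmf : ∀ x k, IsPMF (enc x k)
  dec : Fin n → Fin (msgCard R n) → Fin (keyCard R0 n) →
      (Fin n → X) → (Fin n → Y) → (Fin n → Z) → Y → ℝ
  dec_pmf : ∀ i j k x y z, IsPMF (dec i j k x y z)
  dec_causal : ∀ i j k x y z x' y' z',
      (∀ m, m < i → x m = x' m) → (∀ m, m < i → y m = y' m) →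
      (∀ m, m < i → z m = z' m) →
      dec i j k x y z = dec i j k x' y' z'

/-- An adversary strategy with full causal information:
`{p(zᵢ | j, x^{i-1}, y^{i-1}, z^{i-1})}`. -/
structure Adversary (X Y Z : Type) [Fintype X] [Fintype Y] [Fintype Z]
    (R : ℝ) (n : ℕ) where
  adv : Fin n → Fin (msgCard R n) →
      (Fin n → X) → (Fin n → Y) → (Fin n → Z) → Z → ℝ
  adv_pmf : ∀ i j x y z, IsPMF (adv i j x y z)
  adv_causal : ∀ i j x y z x' y' z',
      (∀ m, m < i → x m = x' m) → (∀ m, m < i → y m = y' m) →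
      (∀ m, m < i → z m = z' m) →
      adv i j x y z = adv i j x' y' z'

/-- Sample space of a block of length `n`: `(Xⁿ, K, J, Yⁿ, Zⁿ)`. -/
abbrev Outc (X Y Z : Type) (R0 R : ℝ) (n : ℕ) : Type :=
  (Fin n → X) × Fin (keyCard R0 n) × Fin (msgCard R n) × (Fin n → Y) × (Fin n → Z)

/-- The induced joint pmf of `(Xⁿ, K, J, Yⁿ, Zⁿ)`:
`p₀ⁿ(xⁿ)·|𝒦|⁻¹·p(j|xⁿ,k)·∏ᵢ p(yᵢ|j,k,x^{i-1},y^{i-1},z^{i-1})·p(zᵢ|j,x^{i-1},y^{i-1},z^{i-1})`. -/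
def jointPMF {X Y Z : Type} [Fintype X] [Fintype Y] [Fintype Z] {R0 R : ℝ} {n : ℕ}
    (p0 : X → ℝ) (S : Scheme X Y Z R0 R n) (A : Adversary X Y Z R n) :
    Outc X Y Z R0 R n → ℝ :=
  fun ω => (∏ i, p0 (ω.1 i)) * ((keyCard R0 n : ℝ))⁻¹ *
    S.enc ω.1 ω.2.1 ω.2.2.1 *
    ∏ i, S.dec i ω.2.2.1 ω.2.1 ω.1 ω.2.2.2.1 ω.2.2.2.2 (ω.2.2.2.1 i) *
      A.adv i ω.2.2.1 ω.1 ω.2.2.2.1 ω.2.2.2.2 (ω.2.2.2.2 i)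

/-- The expected average payoff `E[(1/n) Σᵢ π(Xᵢ, Yᵢ, Zᵢ)]`. -/
def avgValue {X Y Z : Type} [Fintype X] [Fintype Y] [Fintype Z] {R0 R : ℝ} {n : ℕ}
    (p0 : X → ℝ) (π : X → Y → Z → ℝ)
    (S : Scheme X Y Z R0 R n) (A : Adversary X Y Z R n) : ℝ :=
  ∑ ω : Outc X Y Z R0 R n, jointPMF p0 S A ω *
    ((n : ℝ)⁻¹ * ∑ i, π (ω.1 i) (ω.2.2.2.1 i) (ω.2.2.2.2 i))

/-- The robust achievable value `Π_{p₀}(R₀, R)`: the supremum over blocklengths and schemes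
of the least average payoff over all (fully informed) adversary strategies. -/
def robustValue {X Y Z : Type} [Fintype X] [Fintype Y] [Fintype Z]
    (p0 : X → ℝ) (π : X → Y → Z → ℝ) (R0 R : ℝ) : ℝ :=
  ⨆ (n : ℕ) (_ : 0 < n) (S : Scheme X Y Z R0 R n),
    ⨅ A : Adversary X Y Z R n, avgValue p0 π S A

/-! ### Single-letter quantities -/

/-- The single-letter joint pmf of `(X, Y, U, V)` built from the source `p₀` and a
conditional pmf `p(y,u,v|x)`. -/
def slJoint {X Y U V : Type} (p0 : X → ℝ) (w : X → Y × U × V → ℝ) :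
    X × Y × U × V → ℝ :=
  fun q => p0 q.1 * w q.1 q.2

/-- Membership in the single-letter region `𝒫_{p₀}(R₀,R)`: `p(y,u,v|x)` is a conditional pmf,
`X — (U,V) — Y` is a Markov chain, `R₀ ≥ I(X,Y;V|U)` and `R ≥ I(X;U,V)`. -/
def memP {X Y U V : Type} [Fintype X] [Fintype Y] [Fintype U] [Fintype V]
    (p0 : X → ℝ) (w : X → Y × U × V → ℝ) (R0 R : ℝ) : Prop :=
  (∀ x, IsPMF (w x)) ∧
  CondIndep (slJoint p0 w) (fun q => q.1) (fun q => q.2.1) (fun q => q.2.2) ∧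
  R0 ≥ condMutualInfo (slJoint p0 w)
      (fun q => (q.1, q.2.1)) (fun q => q.2.2.2) (fun q => q.2.2.1) ∧
  R ≥ mutualInfo (slJoint p0 w) (fun q => q.1) (fun q => q.2.2)

/-- The expected payoff `E[π(X, Y, z(U))]` when the adversary plays a function `z : U → Z`. -/
def slPayoff {X Y Z U V : Type} [Fintype X] [Fintype Y] [Fintype U] [Fintype V]
    (p0 : X → ℝ) (w : X → Y × U × V → ℝ) (π : X → Y → Z → ℝ) (z : U → Z) : ℝ :=
  ∑ q : X × Y × U × V, slJoint p0 w q * π q.1 q.2.1 (z q.2.2.1)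

/-- The single-letter value `Γ_{p₀,π}(R₀,R)`: the supremum over finite auxiliary alphabets
`𝒰, 𝒱` and conditional pmfs `p(y,u,v|x) ∈ 𝒫_{p₀}(R₀,R)` of `min_{z : 𝒰 → 𝒵} E[π(X,Y,z(U))]`. -/
def Gamma {X Y Z : Type} [Fintype X] [Fintype Y] [Fintype Z]
    (p0 : X → ℝ) (π : X → Y → Z → ℝ) (R0 R : ℝ) : ℝ :=
  sSup {v : ℝ | ∃ (U V : Type) (_ : Fintype U) (_ : Fintype V)
    (w : X → Y × U × V → ℝ), memP p0 w R0 R ∧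
    v = ⨅ z : U → Z, slPayoff p0 w π z}


/-- A decoder is memoryless when each `p(yᵢ | j, k, x^{i-1}, y^{i-1}, z^{i-1})` depends only
on the message `j` and the secret key `k`, i.e. is of the form `p(yᵢ | j, k)`. -/
def MemorylessDecoder {X Y Z : Type} [Fintype X] [Fintype Y] [Fintype Z]
    {R0 R : ℝ} {n : ℕ} (S : Scheme X Y Z R0 R n) : Prop :=
  ∀ i j k x y z x' y' z', S.dec i j k x y z = S.dec i j k x' y' z'

/-! ### Product pmfs -/

theorem sum_pi_prod {ι S : Type} [Fintype ι] [DecidableEq ι] [Fintype S] (F : ι → S → ℝ) :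
    ∑ c : ι → S, ∏ i, F i (c i) = ∏ i, ∑ a, F i a := by
  rw [Finset.prod_univ_sum, Fintype.piFinset_univ]

theorem IsPMF.pi {ι S : Type} [Fintype ι] [DecidableEq ι] [Fintype S] {μ : ι → S → ℝ}
    (h : ∀ i, IsPMF (μ i)) : IsPMF (fun c : ι → S => ∏ i, μ i (c i)) := by
  refine ⟨fun c => Finset.prod_nonneg fun i _ => (h i).1 _, ?_⟩
  rw [sum_pi_prod]
  exact Finset.prod_eq_one fun i _ => (h i).2

theorem IsPMF.le_one {α : Type} [Fintype α] {p : α → ℝ} (h : IsPMF p) (a : α) : p a ≤ 1 := by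
  rw [← h.2]
  exact Finset.single_le_sum (fun b _ => h.1 b) (Finset.mem_univ a)

theorem sum_pi_mul_apply {ι S : Type} [Fintype ι] [DecidableEq ι] [Fintype S] {μ : ι → S → ℝ}
    (h : ∀ i, IsPMF (μ i)) (i₀ : ι) (f : S → ℝ) :
    ∑ c : ι → S, (∏ i, μ i (c i)) * f (c i₀) = ∑ a, μ i₀ a * f a := by
  have key : ∀ c : ι → S, (∏ i, μ i (c i)) * f (c i₀)
      = ∏ i, (μ i (c i) * if i = i₀ then f (c i) else 1) := by
    intro c
    rw [Finset.prod_mul_distrib]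
    simp
  simp_rw [key]
  rw [sum_pi_prod (fun i a => μ i a * if i = i₀ then f a else 1),
    Finset.prod_eq_single i₀]
  · simp
  · intro i _ hi
    simp [hi, (h i).2]
  · simp

theorem sum_pi_mul_apply_mul_apply_eq_zero {ι S : Type} [Fintype ι] [DecidableEq ι] [Fintype S]
    {μ : ι → S → ℝ} {i₀ j₀ : ι} (hij : i₀ ≠ j₀) (f g : S → ℝ)
    (hf : ∑ a, μ i₀ a * f a = 0) :
    ∑ c : ι → S, (∏ i, μ i (c i)) * (f (c i₀) * g (c j₀)) = 0 := by
  have key : ∀ c : ι → S, (∏ i, μ i (c i)) * (f (c i₀) * g (c j₀))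
      = ∏ i, (μ i (c i) * ((if i = i₀ then f (c i) else 1) *
          if i = j₀ then g (c i) else 1)) := by
    intro c
    rw [Finset.prod_mul_distrib, Finset.prod_mul_distrib]
    simp
  simp_rw [key]
  rw [sum_pi_prod (fun i a => μ i a * ((if i = i₀ then f a else 1) *
    if i = j₀ then g a else 1))]
  refine Finset.prod_eq_zero (Finset.mem_univ i₀) ?_
  simpa [hij] using hf

theorem sum_pi_mul_sq_sum {ι S : Type} [Fintype ι] [DecidableEq ι] [Fintype S] {μ : S → ℝ}
    (h : IsPMF μ) (f : S → ℝ) (hf : ∑ a, μ a * f a = 0) :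
    ∑ c : ι → S, (∏ i, μ (c i)) * (∑ i, f (c i)) ^ 2
      = Fintype.card ι * ∑ a, μ a * f a ^ 2 := by
  have key : ∀ c : ι → S, (∏ i, μ (c i)) * (∑ i, f (c i)) ^ 2
      = ∑ i, ∑ j, (∏ i, μ (c i)) * (f (c i) * f (c j)) := by
    intro c
    rw [sq, Finset.sum_mul_sum, Finset.mul_sum]
    simp_rw [Finset.mul_sum]
  simp_rw [key]
  rw [Finset.sum_comm]
  have inner : ∀ i : ι, ∑ c : ι → S, ∑ j, (∏ i, μ (c i)) * (f (c i) * f (c j))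
      = ∑ a, μ a * f a ^ 2 := by
    intro i
    rw [Finset.sum_comm, Finset.sum_eq_single i]
    · simpa [sq] using sum_pi_mul_apply (fun _ : ι => h) i (fun a => f a * f a)
    · intro j _ hj
      exact sum_pi_mul_apply_mul_apply_eq_zero (μ := fun _ => μ) (Ne.symm hj) f f hf
    · simp
  simp_rw [inner]
  simp

theorem sum_mul_abs_le_sqrt {α : Type} [Fintype α] {p : α → ℝ} (h : IsPMF p) (f : α → ℝ) :
    ∑ a, p a * |f a| ≤ √(∑ a, p a * f a ^ 2) := by
  apply Real.le_sqrt_of_sq_le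
  have := Finset.sum_sq_le_sum_mul_sum_of_sq_le_mul Finset.univ
    (r := fun a => p a * |f a|) (f := p) (g := fun a => p a * f a ^ 2)
    (fun a _ => h.1 a) (fun a _ => mul_nonneg (h.1 a) (sq_nonneg _))
    (fun a _ => by rw [mul_pow, sq_abs]; apply le_of_eq; ring)
  simpa [h.2] using this

/-! ### Soft covering and the weak law of large numbers -/

theorem sum_pi_abs_average_sub_le {ι S : Type} [Fintype ι] [DecidableEq ι] [Nonempty ι]
    [Fintype S] {μ : S → ℝ} (h : IsPMF μ) (f : S → ℝ) :
    ∑ c : ι → S, (∏ i, μ (c i)) * |(Fintype.card ι : ℝ)⁻¹ * ∑ i, f (c i) - ∑ a, μ a * f a|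
      ≤ √((∑ a, μ a * f a ^ 2) / Fintype.card ι) := by
  set m := ∑ a, μ a * f a with hm
  have hcard : (0 : ℝ) < Fintype.card ι := by exact_mod_cast Fintype.card_pos
  refine (sum_mul_abs_le_sqrt (IsPMF.pi fun _ : ι => h) _).trans (Real.sqrt_le_sqrt ?_)
  have h0 : ∑ a, μ a * (f a - m) = 0 := by
    simp_rw [mul_sub, Finset.sum_sub_distrib, ← Finset.sum_mul, h.2]
    simp [hm]
  have hsq := sum_pi_mul_sq_sum (ι := ι) h (fun a => f a - m) h0
  have hvar : ∑ a, μ a * (f a - m) ^ 2 ≤ ∑ a, μ a * f a ^ 2 := by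
    have : ∑ a, μ a * (f a - m) ^ 2 = ∑ a, μ a * f a ^ 2 - m ^ 2 := by
      have e : ∀ a, μ a * (f a - m) ^ 2 = μ a * f a ^ 2 - 2 * m * (μ a * f a) + μ a * m ^ 2 := by
        intro a; ring
      simp_rw [e, Finset.sum_add_distrib, Finset.sum_sub_distrib, ← Finset.mul_sum,
        ← Finset.sum_mul, h.2, ← hm]
      ring
    rw [this]; nlinarith [sq_nonneg m]
  have e : ∀ c : ι → S, (∏ i, μ (c i)) * ((Fintype.card ι : ℝ)⁻¹ * ∑ i, f (c i) - m) ^ 2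
      = ((Fintype.card ι : ℝ)⁻¹) ^ 2 * ((∏ i, μ (c i)) * (∑ i, (f (c i) - m)) ^ 2) := by
    intro c
    rw [Finset.sum_sub_distrib]
    simp only [Finset.sum_const, Finset.card_univ, nsmul_eq_mul]
    field_simp
  simp_rw [e, ← Finset.mul_sum, hsq]
  rw [div_eq_inv_mul]
  calc ((Fintype.card ι : ℝ)⁻¹) ^ 2 * (Fintype.card ι * ∑ a, μ a * (f a - m) ^ 2)
      = (Fintype.card ι : ℝ)⁻¹ * ∑ a, μ a * (f a - m) ^ 2 := by field_simp
    _ ≤ _ := by gcongr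

theorem soft_covering {ι S O : Type} [Fintype ι] [DecidableEq ι] [Nonempty ι]
    [Fintype S] [Fintype O] {μ : S → ℝ} (h : IsPMF μ) (W : S → O → ℝ) (hW : ∀ s o, 0 ≤ W s o)
    (w : O → ℝ) (hw : ∀ o, ∑ s, μ s * W s o = w o) (hw1 : ∑ o, w o = 1) (τ : ℝ) (hτ : 0 ≤ τ) :
    ∑ c : ι → S, (∏ i, μ (c i)) * ∑ o, |(Fintype.card ι : ℝ)⁻¹ * ∑ i, W (c i) o - w o|
      ≤ 2 * (∑ s, ∑ o, if τ * w o < W s o then μ s * W s o else 0)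
        + √(τ / Fintype.card ι) := by
  have hcard : (0 : ℝ) < Fintype.card ι := by exact_mod_cast Fintype.card_pos
  have hw0 : ∀ o, 0 ≤ w o := fun o => by
    rw [← hw]; exact Finset.sum_nonneg fun s _ => mul_nonneg (h.1 s) (hW s o)
  set A : S → O → ℝ := fun s o => if τ * w o < W s o then 0 else W s o with hA
  set B : S → O → ℝ := fun s o => if τ * w o < W s o then W s o else 0 with hB
  have hAB : ∀ s o, W s o = A s o + B s o := by
    intro s o; simp only [hA, hB]; split_ifs <;> simp
  have hB0 : ∀ s o, 0 ≤ B s o := by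
    intro s o; simp only [hB]; split_ifs
    · exact hW s o
    · exact le_rfl
  have hpi := IsPMF.pi fun _ : ι => h
  have main : ∀ o, ∑ c : ι → S, (∏ i, μ (c i)) *
      |(Fintype.card ι : ℝ)⁻¹ * ∑ i, W (c i) o - w o|
      ≤ w o * √(τ / Fintype.card ι) + 2 * ∑ s, μ s * B s o := by
    intro o
    have h1 := sum_pi_abs_average_sub_le (ι := ι) h (fun s => A s o)
    have h2 : √((∑ a, μ a * A a o ^ 2) / Fintype.card ι) ≤ w o * √(τ / Fintype.card ι) := by
      have : ∑ a, μ a * A a o ^ 2 ≤ τ * w o * w o := by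
        rw [← hw o, Finset.mul_sum, hw o]
        refine Finset.sum_le_sum fun s _ => ?_
        simp only [hA]
        split_ifs with hs
        · simp only [ne_eq, OfNat.ofNat_ne_zero, not_false_eq_true, zero_pow, mul_zero]
          exact mul_nonneg (mul_nonneg hτ (hw0 o)) (mul_nonneg (h.1 s) (hW s o))
        · have := mul_le_mul_of_nonneg_right (not_lt.1 hs) (mul_nonneg (h.1 s) (hW s o))
          nlinarith
      calc √((∑ a, μ a * A a o ^ 2) / Fintype.card ι)
          ≤ √(w o ^ 2 * (τ / Fintype.card ι)) := by
            apply Real.sqrt_le_sqrt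
            rw [← mul_div_assoc]
            gcongr
            linarith [this, show w o ^ 2 * τ = τ * w o * w o by ring]
        _ = _ := by rw [Real.sqrt_mul (sq_nonneg _), Real.sqrt_sq (hw0 o)]
    have h3 : ∑ c : ι → S, (∏ i, μ (c i)) * ((Fintype.card ι : ℝ)⁻¹ * ∑ i, B (c i) o)
        = ∑ s, μ s * B s o := by
      have e : ∀ c : ι → S, (∏ i, μ (c i)) * ((Fintype.card ι : ℝ)⁻¹ * ∑ i, B (c i) o)
          = (Fintype.card ι : ℝ)⁻¹ * ∑ i, (∏ i, μ (c i)) * B (c i) o := by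
        intro c; rw [← Finset.mul_sum]; ring
      simp_rw [e]
      rw [← Finset.mul_sum, Finset.sum_comm]
      have e2 : ∀ i : ι, ∑ c : ι → S, (∏ i, μ (c i)) * B (c i) o = ∑ s, μ s * B s o := fun i =>
        sum_pi_mul_apply (fun _ : ι => h) i (fun s => B s o)
      simp_rw [e2]
      simp
    calc ∑ c : ι → S, (∏ i, μ (c i)) * |(Fintype.card ι : ℝ)⁻¹ * ∑ i, W (c i) o - w o|
        ≤ ∑ c : ι → S, (∏ i, μ (c i)) *
          (|(Fintype.card ι : ℝ)⁻¹ * ∑ i, A (c i) o - ∑ a, μ a * A a o|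
            + (Fintype.card ι : ℝ)⁻¹ * ∑ i, B (c i) o + ∑ s, μ s * B s o) := by
          refine Finset.sum_le_sum fun c _ => mul_le_mul_of_nonneg_left ?_ (hpi.1 c)
          have hs : 0 ≤ (Fintype.card ι : ℝ)⁻¹ * ∑ i, B (c i) o :=
            mul_nonneg (by positivity) (Finset.sum_nonneg fun i _ => hB0 _ _)
          have hs2 : 0 ≤ ∑ s, μ s * B s o :=
            Finset.sum_nonneg fun s _ => mul_nonneg (h.1 s) (hB0 _ _)
          have e : (Fintype.card ι : ℝ)⁻¹ * ∑ i, W (c i) o - w o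
              = ((Fintype.card ι : ℝ)⁻¹ * ∑ i, A (c i) o - ∑ a, μ a * A a o)
                + ((Fintype.card ι : ℝ)⁻¹ * ∑ i, B (c i) o - ∑ s, μ s * B s o) := by
            rw [← hw o]
            simp_rw [hAB, mul_add, Finset.sum_add_distrib]
            ring
          rw [e]
          refine (abs_add_le _ _).trans ?_
          rw [add_assoc]
          gcongr
          rw [abs_le]
          constructor <;> linarith
      _ ≤ _ := by
          simp_rw [mul_add, Finset.sum_add_distrib, h3, ← Finset.sum_mul, hpi.2]
          linarith
  calc _ = ∑ o, ∑ c : ι → S, (∏ i, μ (c i)) *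
      |(Fintype.card ι : ℝ)⁻¹ * ∑ i, W (c i) o - w o| := by
        rw [Finset.sum_comm]
        simp_rw [Finset.mul_sum]
    _ ≤ ∑ o, (w o * √(τ / Fintype.card ι) + 2 * ∑ s, μ s * B s o) :=
        Finset.sum_le_sum fun o _ => main o
    _ = _ := by
        rw [Finset.sum_add_distrib, ← Finset.sum_mul, hw1, ← Finset.mul_sum, Finset.sum_comm]
        simp only [hB, mul_ite, mul_zero]
        ring

theorem exists_iid_tail_bound {Θ : Type} [Fintype Θ] {ρ : Θ → ℝ} (h : IsPMF ρ)
    (num den : Θ → ℝ) (hpos : ∀ θ, ρ θ ≠ 0 → 0 < num θ ∧ 0 < den θ)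
    (I : ℝ) (hI : ∑ θ, ρ θ * Real.log (num θ / den θ) = I) {δ : ℝ} (hδ : 0 < δ) :
    ∃ C : ℝ, ∀ N : ℕ, 0 < N →
      (∑ θ : Fin N → Θ, if Real.exp (N * (I + δ)) * ∏ i, den (θ i) < ∏ i, num (θ i)
        then ∏ i, ρ (θ i) else 0) ≤ C / N := by
  set f : Θ → ℝ := fun θ => Real.log (num θ / den θ) - I with hf
  refine ⟨(∑ θ, ρ θ * f θ ^ 2) / δ ^ 2, fun N hN => ?_⟩
  have hN' : (0 : ℝ) < N := by exact_mod_cast hN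
  have h0 : ∑ θ, ρ θ * f θ = 0 := by
    simp only [hf, mul_sub, Finset.sum_sub_distrib, ← Finset.sum_mul, h.2, hI]
    ring
  have hsq := sum_pi_mul_sq_sum (ι := Fin N) h f h0
  have hpi := IsPMF.pi fun _ : Fin N => h
  have key : ∀ θ : Fin N → Θ,
      (if Real.exp (N * (I + δ)) * ∏ i, den (θ i) < ∏ i, num (θ i)
        then ∏ i, ρ (θ i) else 0)
      ≤ ((∏ i, ρ (θ i)) * (∑ i, f (θ i)) ^ 2) / (N * δ) ^ 2 := by
    intro θ
    have hp := hpi.1 θ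
    split_ifs with hlt
    · by_cases hz : ∏ i, ρ (θ i) = 0
      · rw [hz]; simp
      · have hz' : ∀ i, ρ (θ i) ≠ 0 := fun i hi =>
          hz (Finset.prod_eq_zero (Finset.mem_univ i) hi)
        have hd : 0 < ∏ i, den (θ i) := Finset.prod_pos fun i _ => (hpos _ (hz' i)).2
        rw [← lt_div_iff₀ hd, ← Finset.prod_div_distrib] at hlt
        have hlog := Real.log_lt_log (Real.exp_pos _) hlt
        rw [Real.log_exp, Real.log_prod (fun i _ =>
          (div_pos (hpos _ (hz' i)).1 (hpos _ (hz' i)).2).ne')] at hlog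
        have hge : N * δ ≤ ∑ i, f (θ i) := by
          simp only [hf, Finset.sum_sub_distrib, Finset.sum_const, Finset.card_univ,
            Fintype.card_fin, nsmul_eq_mul]
          linarith
        rw [le_div_iff₀ (by positivity)]
        have : 0 < N * δ := by positivity
        gcongr
    · positivity
  refine (Finset.sum_le_sum fun θ _ => key θ).trans ?_
  rw [← Finset.sum_div, hsq, Fintype.card_fin]
  apply le_of_eq
  field_simp

/-! ### Causal kernels -/

/-- A family of conditional pmfs `κ i ω` for the `i`-th letter, depending only on the letters of
`ω` before time `i`. -/
def IsCausalKernel {Ω : Type} [Fintype Ω] {n : ℕ} (κ : Fin n → (Fin n → Ω) → Ω → ℝ) : Prop :=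
  (∀ i ω, IsPMF (κ i ω)) ∧ ∀ i ω ω', (∀ m, m < i → ω m = ω' m) → κ i ω = κ i ω'

theorem sum_fin_cons {Ω : Type} [Fintype Ω] {n : ℕ} (F : (Fin (n + 1) → Ω) → ℝ) :
    ∑ ω, F ω = ∑ a, ∑ ω : Fin n → Ω, F (Fin.cons a ω) := by
  rw [← (Fin.consEquiv fun _ : Fin (n + 1) => Ω).sum_comp, Fintype.sum_prod_type]
  rfl

theorem IsCausalKernel.tail {Ω : Type} [Fintype Ω] {n : ℕ}
    {κ : Fin (n + 1) → (Fin (n + 1) → Ω) → Ω → ℝ} (h : IsCausalKernel κ) (a : Ω) :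
    IsCausalKernel fun (i : Fin n) (ω : Fin n → Ω) => κ i.succ (Fin.cons a ω) := by
  refine ⟨fun i ω => h.1 _ _, fun i ω ω' hm => h.2 _ _ _ fun m => ?_⟩
  refine Fin.cases (fun _ => by simp) (fun m hlt => ?_) m
  simpa using hm m (Fin.succ_lt_succ_iff.1 hlt)

theorem IsCausalKernel.sum_cons {Ω : Type} [Fintype Ω] {n : ℕ}
    {κ : Fin (n + 1) → (Fin (n + 1) → Ω) → Ω → ℝ} (h : IsCausalKernel κ) (ω₀ : Fin (n + 1) → Ω)
    (F : (Fin (n + 1) → Ω) → ℝ) :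
    ∑ ω, (∏ i, κ i ω (ω i)) * F ω = ∑ a, κ 0 ω₀ a *
      ∑ ω : Fin n → Ω, (∏ i : Fin n, κ i.succ (Fin.cons a ω) (ω i)) * F (Fin.cons a ω) := by
  rw [sum_fin_cons]
  refine Finset.sum_congr rfl fun a _ => ?_
  rw [Finset.mul_sum]
  refine Finset.sum_congr rfl fun ω _ => ?_
  rw [Fin.prod_univ_succ, h.2 0 (Fin.cons a ω) ω₀ (fun m hm => absurd hm (Fin.not_lt_zero m))]
  simp only [Fin.cons_zero, Fin.cons_succ]
  ring

theorem IsCausalKernel.sum_eq_one {Ω : Type} [Fintype Ω] [Nonempty Ω] {n : ℕ}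
    {κ : Fin n → (Fin n → Ω) → Ω → ℝ} (h : IsCausalKernel κ) :
    ∑ ω, ∏ i, κ i ω (ω i) = 1 := by
  induction n with
  | zero => simp
  | succ n ih =>
    have := h.sum_cons (fun _ => Classical.arbitrary Ω) (fun _ => 1)
    simp only [mul_one] at this
    rw [this]
    have e : ∀ a, ∑ ω : Fin n → Ω, (∏ i : Fin n, κ i.succ (Fin.cons a ω) (ω i)) = 1 :=
      fun a => ih (h.tail a)
    simp_rw [e, mul_one]
    exact (h.1 _ _).2

theorem IsCausalKernel.prod_nonneg {Ω : Type} [Fintype Ω] {n : ℕ}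
    {κ : Fin n → (Fin n → Ω) → Ω → ℝ} (h : IsCausalKernel κ) (ω : Fin n → Ω) :
    0 ≤ ∏ i, κ i ω (ω i) :=
  Finset.prod_nonneg fun i _ => (h.1 i ω).1 _

theorem IsCausalKernel.isPMF {Ω : Type} [Fintype Ω] [Nonempty Ω] {n : ℕ}
    {κ : Fin n → (Fin n → Ω) → Ω → ℝ} (h : IsCausalKernel κ) :
    IsPMF fun ω : Fin n → Ω => ∏ i, κ i ω (ω i) :=
  ⟨h.prod_nonneg, h.sum_eq_one⟩

theorem IsCausalKernel.sum_nonneg {Ω : Type} [Fintype Ω] [Nonempty Ω] {n : ℕ}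
    {κ : Fin n → (Fin n → Ω) → Ω → ℝ} (h : IsCausalKernel κ) (f : Fin n → (Fin n → Ω) → ℝ)
    (hf : ∀ t ω ω', (∀ m, m ≤ t → ω m = ω' m) → f t ω = f t ω')
    (hpos : ∀ t ω, 0 ≤ ∑ a, κ t ω a * f t (Function.update ω t a)) :
    0 ≤ ∑ ω, (∏ i, κ i ω (ω i)) * ∑ t, f t ω := by
  induction n with
  | zero => simp
  | succ n ih =>
    set ω₀ : Fin (n + 1) → Ω := fun _ => Classical.arbitrary Ω with hω₀
    rw [h.sum_cons ω₀]
    have split : ∀ a, ∑ ω : Fin n → Ω, (∏ i : Fin n, κ i.succ (Fin.cons a ω) (ω i)) *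
        ∑ t, f t (Fin.cons a ω) = f 0 (Function.update ω₀ 0 a) +
        ∑ ω : Fin n → Ω, (∏ i : Fin n, κ i.succ (Fin.cons a ω) (ω i)) *
          ∑ t : Fin n, f t.succ (Fin.cons a ω) := by
      intro a
      have e : ∀ ω : Fin n → Ω, f 0 (Fin.cons a ω) = f 0 (Function.update ω₀ 0 a) := by
        intro ω
        refine hf _ _ _ fun m hm => ?_
        obtain rfl : m = 0 := Fin.le_zero_iff.1 hm
        simp
      simp_rw [Fin.sum_univ_succ, e, mul_add, Finset.sum_add_distrib, ← Finset.sum_mul,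
        (h.tail a).sum_eq_one, one_mul]
    simp_rw [split, mul_add, Finset.sum_add_distrib]
    refine add_nonneg (hpos 0 ω₀) (Finset.sum_nonneg fun a _ => mul_nonneg ((h.1 _ _).1 _) ?_)
    refine ih (h.tail a) (fun t ω => f t.succ (Fin.cons a ω)) ?_ ?_
    · intro t ω ω' hm
      refine hf _ _ _ fun m => ?_
      refine Fin.cases (fun _ => by simp) (fun m hle => ?_) m
      simpa using hm m (Fin.succ_le_succ_iff.1 hle)
    · intro t ω
      have := hpos t.succ (Fin.cons a ω)
      simpa only [Fin.cons_update] using this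

/-! ### Value of a scheme -/

theorem sum_arrow_prod {n : ℕ} {Y Z : Type} [Fintype Y] [Fintype Z]
    (F : (Fin n → Y) → (Fin n → Z) → ℝ) :
    ∑ y, ∑ z, F y z = ∑ ω : Fin n → Y × Z, F (fun i => (ω i).1) fun i => (ω i).2 := by
  rw [← (Equiv.arrowProdEquivProdArrow (Fin n) (fun _ => Y) (fun _ => Z)).symm.sum_comp,
    Fintype.sum_prod_type]
  rfl

theorem keyCard_pos (R0 : ℝ) (n : ℕ) : 0 < keyCard R0 n := lt_of_lt_of_le one_pos (le_max_left _ _)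

theorem msgCard_pos (R : ℝ) (n : ℕ) : 0 < msgCard R n := lt_of_lt_of_le one_pos (le_max_left _ _)

instance (R0 : ℝ) (n : ℕ) : Nonempty (Fin (keyCard R0 n)) := ⟨⟨0, keyCard_pos R0 n⟩⟩

instance (R : ℝ) (n : ℕ) : Nonempty (Fin (msgCard R n)) := ⟨⟨0, msgCard_pos R n⟩⟩

theorem isPMF_ite_eq {α : Type} [Fintype α] (a₀ : α) :
    IsPMF fun a => if a = a₀ then (1 : ℝ) else 0 := by
  refine ⟨fun a => by dsimp only; split_ifs <;> norm_num, by simp⟩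

instance {X Y Z : Type} [Fintype X] [Fintype Y] [Fintype Z] [Nonempty Z] (R : ℝ) (n : ℕ) :
    Nonempty (Adversary X Y Z R n) :=
  ⟨{ adv := fun _ _ _ _ _ z => if z = Classical.arbitrary Z then 1 else 0
     adv_pmf := fun _ _ _ _ _ => isPMF_ite_eq _
     adv_causal := fun _ _ _ _ _ _ _ _ _ _ _ => rfl }⟩

section

variable {X Y Z : Type} [Fintype X] [Fintype Y] [Fintype Z]

theorem avgValue_eq {R0 R : ℝ} {n : ℕ} (p0 : X → ℝ) (π : X → Y → Z → ℝ)
    (S : Scheme X Y Z R0 R n) (A : Adversary X Y Z R n) :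
    avgValue p0 π S A = ∑ x : Fin n → X, ∑ k, ∑ j,
      (∏ i, p0 (x i)) * (keyCard R0 n : ℝ)⁻¹ * S.enc x k j *
      ∑ y : Fin n → Y, ∑ z : Fin n → Z,
        (∏ i, S.dec i j k x y z (y i) * A.adv i j x y z (z i)) *
          ((n : ℝ)⁻¹ * ∑ i, π (x i) (y i) (z i)) := by
  unfold avgValue jointPMF
  simp only [Fintype.sum_prod_type, Finset.mul_sum, mul_assoc]

theorem isCausalKernel_dec_adv {R0 R : ℝ} {n : ℕ} (S : Scheme X Y Z R0 R n)
    (A : Adversary X Y Z R n) (x : Fin n → X) (k : Fin (keyCard R0 n)) (j : Fin (msgCard R n)) :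
    IsCausalKernel fun (i : Fin n) (ω : Fin n → Y × Z) (a : Y × Z) =>
      S.dec i j k x (fun m => (ω m).1) (fun m => (ω m).2) a.1 *
        A.adv i j x (fun m => (ω m).1) (fun m => (ω m).2) a.2 := by
  refine ⟨fun i ω => ⟨fun a => mul_nonneg ((S.dec_pmf _ _ _ _ _ _).1 _)
    ((A.adv_pmf _ _ _ _ _).1 _), ?_⟩, fun i ω ω' hm => ?_⟩
  · rw [Fintype.sum_prod_type]
    simp_rw [← Finset.mul_sum, (A.adv_pmf _ _ _ _ _).2, mul_one, (S.dec_pmf _ _ _ _ _ _).2]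
  · funext a
    dsimp only
    rw [S.dec_causal i j k x (fun m => (ω m).1) (fun m => (ω m).2) x (fun m => (ω' m).1)
      (fun m => (ω' m).2) (fun _ _ => rfl)
      (fun m h => by rw [hm m h]) (fun m h => by rw [hm m h]),
      A.adv_causal i j x (fun m => (ω m).1) (fun m => (ω m).2) x (fun m => (ω' m).1)
      (fun m => (ω' m).2) (fun _ _ => rfl)
      (fun m h => by rw [hm m h]) (fun m h => by rw [hm m h])]

theorem isPMF_jointPMF [Nonempty Y] [Nonempty Z] {R0 R : ℝ} {n : ℕ} {p0 : X → ℝ} (hp0 : IsPMF p0)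
    (S : Scheme X Y Z R0 R n) (A : Adversary X Y Z R n) : IsPMF (jointPMF p0 S A) := by
  refine ⟨fun ω => ?_, ?_⟩
  · unfold jointPMF
    refine mul_nonneg (mul_nonneg (mul_nonneg (Finset.prod_nonneg fun i _ => hp0.1 _)
      (by positivity)) ((S.enc_pmf _ _).1 _)) (Finset.prod_nonneg fun i _ =>
        mul_nonneg ((S.dec_pmf _ _ _ _ _ _).1 _) ((A.adv_pmf _ _ _ _ _).1 _))
  · unfold jointPMF
    simp only [Fintype.sum_prod_type, ← Finset.mul_sum]
    have e : ∀ (x : Fin n → X) k j, ∑ y : Fin n → Y, ∑ z : Fin n → Z,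
        (∏ i, S.dec i j k x y z (y i) * A.adv i j x y z (z i)) = 1 := by
      intro x k j
      rw [sum_arrow_prod]
      exact (isCausalKernel_dec_adv S A x k j).sum_eq_one
    have hk : (keyCard R0 n : ℝ) ≠ 0 := by exact_mod_cast (keyCard_pos R0 n).ne'
    simp_rw [e, mul_one, ← Finset.mul_sum, (S.enc_pmf _ _).2, Finset.sum_const, Finset.card_univ,
      Fintype.card_fin, nsmul_eq_mul]
    simp_rw [mul_one, inv_mul_cancel_right₀ hk]
    exact (IsPMF.pi fun _ : Fin n => hp0).2

theorem abs_average_le {n : ℕ} {B : ℝ} (hB0 : 0 ≤ B) (f : Fin n → ℝ) (hf : ∀ i, |f i| ≤ B) :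
    |(n : ℝ)⁻¹ * ∑ i, f i| ≤ B := by
  rcases Nat.eq_zero_or_pos n with rfl | hn
  · simpa using hB0
  · have hn' : (0 : ℝ) < n := by exact_mod_cast hn
    rw [abs_mul, abs_of_nonneg (by positivity : (0 : ℝ) ≤ (n : ℝ)⁻¹), inv_mul_le_iff₀ hn']
    refine (Finset.abs_sum_le_sum_abs _ _).trans ?_
    refine (Finset.sum_le_sum fun i _ => hf i).trans ?_
    simp

theorem IsPMF.abs_sum_mul_le {α : Type} [Fintype α] {p : α → ℝ} (h : IsPMF p) {B : ℝ}
    (f : α → ℝ) (hf : ∀ a, |f a| ≤ B) : |∑ a, p a * f a| ≤ B := by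
  refine (Finset.abs_sum_le_sum_abs _ _).trans ?_
  calc ∑ a, |p a * f a| ≤ ∑ a, p a * B := Finset.sum_le_sum fun a _ => by
        rw [abs_mul, abs_of_nonneg (h.1 a)]
        exact mul_le_mul_of_nonneg_left (hf a) (h.1 a)
    _ = B := by rw [← Finset.sum_mul, h.2, one_mul]

theorem abs_avgValue_le [Nonempty Y] [Nonempty Z] {R0 R : ℝ} {n : ℕ} {p0 : X → ℝ}
    (hp0 : IsPMF p0) {π : X → Y → Z → ℝ} {B : ℝ} (hB0 : 0 ≤ B) (hB : ∀ x y z, |π x y z| ≤ B)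
    (S : Scheme X Y Z R0 R n) (A : Adversary X Y Z R n) : |avgValue p0 π S A| ≤ B :=
  (isPMF_jointPMF hp0 S A).abs_sum_mul_le _ fun _ => abs_average_le hB0 _ fun _ => hB _ _ _

theorem le_iSup_iSup_iSup {ι : Type} {P : ι → Prop} {σ : ι → Type} (f : ∀ i, P i → σ i → ℝ)
    {B : ℝ} (hB0 : 0 ≤ B) (hB : ∀ i p s, f i p s ≤ B) (i : ι) (p : P i) (s : σ i) :
    f i p s ≤ ⨆ (i : ι) (p : P i) (s : σ i), f i p s := by
  have h1 : ∀ i p, (⨆ s, f i p s) ≤ B := fun i p => Real.iSup_le (hB i p) hB0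
  have h2 : ∀ i, (⨆ (p : P i) (s : σ i), f i p s) ≤ B := fun i => Real.iSup_le (h1 i) hB0
  exact le_ciSup_of_le ⟨B, by rintro _ ⟨i, rfl⟩; exact h2 i⟩ i
    (le_ciSup_of_le ⟨B, by rintro _ ⟨p, rfl⟩; exact h1 i p⟩ p
      (le_ciSup ⟨B, by rintro _ ⟨s, rfl⟩; exact hB i p s⟩ s))

theorem exists_abs_payoff_le (π : X → Y → Z → ℝ) : ∃ B, 0 ≤ B ∧ ∀ x y z, |π x y z| ≤ B := by
  refine ⟨∑ q : X × Y × Z, |π q.1 q.2.1 q.2.2|, Finset.sum_nonneg fun _ _ => abs_nonneg _,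
    fun x y z => ?_⟩
  exact Finset.single_le_sum (f := fun q : X × Y × Z => |π q.1 q.2.1 q.2.2|)
    (fun _ _ => abs_nonneg _) (Finset.mem_univ (x, y, z))

theorem iSup_memoryless_eq_robustValue [Nonempty Y] [Nonempty Z]
    {p0 : X → ℝ} (hp0 : IsPMF p0) (π : X → Y → Z → ℝ) (R0 R : ℝ)
    (H : ∀ (n : ℕ) (_ : 0 < n) (S : Scheme X Y Z R0 R n) (ε : ℝ), 0 < ε →
      ∃ (N : ℕ) (_ : 0 < N) (S' : Scheme X Y Z R0 R N), MemorylessDecoder S' ∧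
        ∀ A', (⨅ A, avgValue p0 π S A) - ε ≤ avgValue p0 π S' A') :
    (⨆ (n : ℕ) (_ : 0 < n) (S : Scheme X Y Z R0 R n) (_ : MemorylessDecoder S),
        ⨅ A : Adversary X Y Z R n, avgValue p0 π S A)
      = robustValue p0 π R0 R := by
  obtain ⟨B, hB0, hB⟩ := exists_abs_payoff_le π
  have hbd : ∀ {n : ℕ} (S : Scheme X Y Z R0 R n), (⨅ A, avgValue p0 π S A) ≤ B := by
    intro n S
    refine ciInf_le_of_le ⟨-B, ?_⟩ (Classical.arbitrary _)
      (abs_le.1 (abs_avgValue_le hp0 hB0 hB S _)).2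
    rintro _ ⟨A, rfl⟩
    exact (abs_le.1 (abs_avgValue_le hp0 hB0 hB S A)).1
  have hL := le_iSup_iSup_iSup
    (f := fun (n : ℕ) (_ : 0 < n) (S : Scheme X Y Z R0 R n) =>
      ⨆ (_ : MemorylessDecoder S), ⨅ A : Adversary X Y Z R n, avgValue p0 π S A) hB0
    (fun n _ S => Real.iSup_le (fun _ => hbd S) hB0)
  have hR := le_iSup_iSup_iSup
    (f := fun (n : ℕ) (_ : 0 < n) (S : Scheme X Y Z R0 R n) =>
      ⨅ A : Adversary X Y Z R n, avgValue p0 π S A) hB0 (fun n _ S => hbd S)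
  have h1 : ∀ n (hn : 0 < n) (S : Scheme X Y Z R0 R n),
      (⨆ (_ : MemorylessDecoder S), ⨅ A : Adversary X Y Z R n, avgValue p0 π S A) ≤ B :=
    fun n _ S => Real.iSup_le (fun _ => hbd S) hB0
  have hL0 : 0 ≤ (⨆ (n : ℕ) (_ : 0 < n) (S : Scheme X Y Z R0 R n) (_ : MemorylessDecoder S),
        ⨅ A : Adversary X Y Z R n, avgValue p0 π S A) := by
    refine le_ciSup_of_le ⟨B, ?_⟩ 0 (by simp)
    rintro _ ⟨n, rfl⟩
    exact Real.iSup_le (fun hn => Real.iSup_le (h1 n hn) hB0) hB0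
  have hR0 : 0 ≤ robustValue p0 π R0 R := by
    refine le_ciSup_of_le ⟨B, ?_⟩ 0 (by simp)
    rintro _ ⟨n, rfl⟩
    exact Real.iSup_le (fun hn => Real.iSup_le hbd hB0) hB0
  apply le_antisymm
  · exact Real.iSup_le (fun n => Real.iSup_le (fun hn => Real.iSup_le (fun S =>
      Real.iSup_le (fun _ => hR n hn S) hR0) hR0) hR0) hR0
  · refine Real.iSup_le (fun n => Real.iSup_le (fun hn => Real.iSup_le (fun S => ?_) hL0)
      hL0) hL0
    refine le_of_forall_pos_le_add fun ε hε => ?_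
    obtain ⟨N, hN, S', hS', hA⟩ := H n hn S ε hε
    have := hL N hN S'
    simp only [hS', ciSup_unique] at this
    linarith [le_ciInf hA]

end

/-! ### The likelihood encoder -/

section

variable {X Y Z : Type} [Fintype X] [Fintype Y] [Fintype Z]

/-- The conditional expected average payoff given the message and the actions `xⁿ`, `yⁿ`. -/
def advPayoff {R : ℝ} {n : ℕ} (π : X → Y → Z → ℝ) (A : Adversary X Y Z R n)
    (j : Fin (msgCard R n)) (x : Fin n → X) (y : Fin n → Y) : ℝ :=
  ∑ z : Fin n → Z, (∏ i, A.adv i j x y z (z i)) * ((n : ℝ)⁻¹ * ∑ i, π (x i) (y i) (z i))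

theorem abs_advPayoff_le [Nonempty Z] {R : ℝ} {n : ℕ} {π : X → Y → Z → ℝ} {B : ℝ} (hB0 : 0 ≤ B)
    (hB : ∀ x y z, |π x y z| ≤ B) (A : Adversary X Y Z R n) (j : Fin (msgCard R n))
    (x : Fin n → X) (y : Fin n → Y) : |advPayoff π A j x y| ≤ B := by
  have hk : IsCausalKernel fun (i : Fin n) (z : Fin n → Z) => A.adv i j x y z :=
    ⟨fun i z => A.adv_pmf _ _ _ _ _, fun i z z' h =>
      A.adv_causal _ _ _ _ _ _ _ _ (fun _ _ => rfl) (fun _ _ => rfl) h⟩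
  exact hk.isPMF.abs_sum_mul_le _ fun _ => abs_average_le hB0 _ fun _ => hB _ _ _

theorem average_le_sum_mul_advPayoff [Nonempty X] [Nonempty Y] [Nonempty Z] {R : ℝ} {n : ℕ}
    (π : X → Y → Z → ℝ) (A : Adversary X Y Z R n) (j : Fin (msgCard R n))
    {E : Fin n → X × Y → ℝ} (hE : ∀ i, IsPMF (E i)) (m : Fin n → ℝ)
    (hm : ∀ i z, m i ≤ ∑ a, E i a * π a.1 a.2 z) :
    (n : ℝ)⁻¹ * ∑ i, m i ≤ ∑ ω : Fin n → X × Y, (∏ i, E i (ω i)) *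
      advPayoff π A j (fun i => (ω i).1) fun i => (ω i).2 := by
  set κ : Fin n → (Fin n → (X × Y) × Z) → (X × Y) × Z → ℝ := fun i θ a =>
    E i a.1 * A.adv i j (fun m => (θ m).1.1) (fun m => (θ m).1.2) (fun m => (θ m).2) a.2 with hκ
  have hc : IsCausalKernel κ := by
    refine ⟨fun i θ => ⟨fun a => mul_nonneg ((hE i).1 _) ((A.adv_pmf _ _ _ _ _).1 _), ?_⟩,
      fun i θ θ' h => ?_⟩
    · simp only [hκ]
      rw [Fintype.sum_prod_type]
      simp_rw [← Finset.mul_sum, (A.adv_pmf _ _ _ _ _).2, mul_one, (hE i).2]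
    · funext a
      simp only [hκ]
      rw [A.adv_causal i j (fun m => (θ m).1.1) (fun m => (θ m).1.2) (fun m => (θ m).2)
        (fun m => (θ' m).1.1) (fun m => (θ' m).1.2) (fun m => (θ' m).2)
        (fun m hm => by rw [h m hm]) (fun m hm => by rw [h m hm]) (fun m hm => by rw [h m hm])]
  have hpos := hc.sum_nonneg (fun t θ => π (θ t).1.1 (θ t).1.2 (θ t).2 - m t)
    (fun t θ θ' h => by simp only [h t le_rfl]) ?_
  · simp_rw [Finset.sum_sub_distrib, mul_sub, Finset.sum_sub_distrib, ← Finset.sum_mul,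
      hc.sum_eq_one, one_mul] at hpos
    have e : ∑ ω : Fin n → X × Y, (∏ i, E i (ω i)) *
        advPayoff π A j (fun i => (ω i).1) (fun i => (ω i).2)
        = (n : ℝ)⁻¹ * ∑ θ, (∏ i, κ i θ (θ i)) * ∑ i, π (θ i).1.1 (θ i).1.2 (θ i).2 := by
      unfold advPayoff
      simp_rw [Finset.mul_sum Finset.univ (fun z : Fin n → Z => _)]
      rw [sum_arrow_prod, Finset.mul_sum]
      refine Finset.sum_congr rfl fun θ _ => ?_
      simp only [hκ, Finset.prod_mul_distrib]
      ring
    rw [e]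
    refine mul_le_mul_of_nonneg_left ?_ (by positivity)
    linarith
  · intro t θ
    simp only [hκ, Function.update_self]
    rw [Fintype.sum_prod_type, Finset.sum_comm]
    refine Finset.sum_nonneg fun z _ => ?_
    have e : ∀ a : X × Y, E t a * A.adv t j (fun m => (θ m).1.1) (fun m => (θ m).1.2)
        (fun m => (θ m).2) z * (π a.1 a.2 z - m t)
        = A.adv t j (fun m => (θ m).1.1) (fun m => (θ m).1.2) (fun m => (θ m).2) z *
          (E t a * π a.1 a.2 z - E t a * m t) := by
      intro a; ring
    simp_rw [e]
    rw [← Finset.mul_sum, Finset.sum_sub_distrib, ← Finset.sum_mul, (hE t).2, one_mul]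
    exact mul_nonneg ((A.adv_pmf _ _ _ _ _).1 _) (sub_nonneg.2 (hm t z))

variable {U V : Type}

/-- The scheme with codewords `uⁿ(j)`, `vⁿ(j,k)`: the encoder picks a message with probability
proportional to the likelihood of `xⁿ`, and the decoder passes the codewords through `D`. -/
def codeScheme {R0 R : ℝ} {n : ℕ} {W : U → V → X → ℝ} (hW : ∀ u v, IsPMF (W u v))
    {D : U → V → Y → ℝ} (hD : ∀ u v, IsPMF (D u v)) (cu : Fin (msgCard R n) → Fin n → U)
    (cv : Fin (msgCard R n) → Fin (keyCard R0 n) → Fin n → V) : Scheme X Y Z R0 R n where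
  enc x k j :=
    if ∑ j', ∏ i, W (cu j' i) (cv j' k i) (x i) = 0 then (msgCard R n : ℝ)⁻¹
    else (∏ i, W (cu j i) (cv j k i) (x i)) / ∑ j', ∏ i, W (cu j' i) (cv j' k i) (x i)
  enc_pmf x k := by
    have hM : (msgCard R n : ℝ) ≠ 0 := by exact_mod_cast (msgCard_pos R n).ne'
    have h0 : ∀ j, 0 ≤ ∏ i, W (cu j i) (cv j k i) (x i) := fun j =>
      Finset.prod_nonneg fun i _ => (hW _ _).1 _
    split_ifs with h
    · refine ⟨fun j => by positivity, ?_⟩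
      simp [hM]
    · refine ⟨fun j => div_nonneg (h0 j) (Finset.sum_nonneg fun j _ => h0 j), ?_⟩
      rw [← Finset.sum_div, div_self h]
  dec i j k _ _ _ := D (cu j i) (cv j k i)
  dec_pmf _ _ _ _ _ _ := hD _ _
  dec_causal _ _ _ _ _ _ _ _ _ _ _ _ := rfl

theorem le_avgValue_codeScheme [Nonempty X] [Nonempty Y] [Nonempty Z] {R0 R : ℝ} {n : ℕ}
    (p0 : X → ℝ) {π : X → Y → Z → ℝ} {B : ℝ} (hB0 : 0 ≤ B) (hB : ∀ x y z, |π x y z| ≤ B)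
    {W : U → V → X → ℝ} (hW : ∀ u v, IsPMF (W u v))
    {D : U → V → Y → ℝ} (hD : ∀ u v, IsPMF (D u v))
    {E : U → X × Y → ℝ} (hE : ∀ u, IsPMF (E u)) (m : U → ℝ)
    (hm : ∀ u z, m u ≤ ∑ a, E u a * π a.1 a.2 z) (cu : Fin (msgCard R n) → Fin n → U)
    (cv : Fin (msgCard R n) → Fin (keyCard R0 n) → Fin n → V) (A : Adversary X Y Z R n) :
    (msgCard R n : ℝ)⁻¹ * ∑ j, ((n : ℝ)⁻¹ * ∑ i, m (cu j i))
      - B * ((keyCard R0 n : ℝ)⁻¹ * ∑ k, ∑ x : Fin n → X,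
          |(msgCard R n : ℝ)⁻¹ * ∑ j, ∏ i, W (cu j i) (cv j k i) (x i) - ∏ i, p0 (x i)|)
      - B * ((msgCard R n : ℝ)⁻¹ * ∑ j, ∑ ω : Fin n → X × Y,
          |(keyCard R0 n : ℝ)⁻¹ * ∑ k, ∏ i, (W (cu j i) (cv j k i) (ω i).1 *
            D (cu j i) (cv j k i) (ω i).2) - ∏ i, E (cu j i) (ω i)|)
    ≤ avgValue p0 π (codeScheme hW hD cu cv) A := by
  have hM : (0 : ℝ) < msgCard R n := by exact_mod_cast msgCard_pos R n
  have hL : (0 : ℝ) < keyCard R0 n := by exact_mod_cast keyCard_pos R0 n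
  set S : Scheme X Y Z R0 R n := codeScheme hW hD cu cv with hS
  set WN : Fin (msgCard R n) → Fin (keyCard R0 n) → (Fin n → X) → ℝ := fun j k x =>
    ∏ i, W (cu j i) (cv j k i) (x i) with hWN
  set DN : Fin (msgCard R n) → Fin (keyCard R0 n) → (Fin n → Y) → ℝ := fun j k y =>
    ∏ i, D (cu j i) (cv j k i) (y i) with hDN
  set h : (Fin n → X) → Fin (keyCard R0 n) → Fin (msgCard R n) → ℝ := fun x k j =>
    ∑ y, DN j k y * advPayoff π A j x y with hh
  have hWN0 : ∀ j k x, 0 ≤ WN j k x := fun j k x => Finset.prod_nonneg fun i _ => (hW _ _).1 _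
  have hhB : ∀ x k j, |h x k j| ≤ B := fun x k j =>
    (IsPMF.pi fun i => hD (cu j i) (cv j k i)).abs_sum_mul_le _ fun y =>
      abs_advPayoff_le hB0 hB A j x y
  have value : avgValue p0 π S A = ∑ x : Fin n → X, ∑ k, ∑ j,
      (∏ i, p0 (x i)) * (keyCard R0 n : ℝ)⁻¹ * S.enc x k j * h x k j := by
    rw [avgValue_eq]
    refine Finset.sum_congr rfl fun x _ => Finset.sum_congr rfl fun k _ =>
      Finset.sum_congr rfl fun j _ => ?_
    congr 1
    refine Finset.sum_congr rfl fun y _ => ?_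
    simp only [advPayoff, hDN, Finset.mul_sum Finset.univ (fun z : Fin n → Z => _)]
    refine Finset.sum_congr rfl fun z _ => ?_
    rw [Finset.prod_mul_distrib, mul_assoc]
    rfl
  have likelihood : ∀ x k j, (msgCard R n : ℝ)⁻¹ * WN j k x
      = ((msgCard R n : ℝ)⁻¹ * ∑ j', WN j' k x) * S.enc x k j := by
    intro x k j
    by_cases hz : ∑ j', WN j' k x = 0
    · have : WN j k x = 0 := (Finset.sum_eq_zero_iff_of_nonneg fun j _ => hWN0 j k x).1 hz j
        (Finset.mem_univ j)
      rw [hz, this]; ring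
    · have : S.enc x k j = WN j k x / ∑ j', WN j' k x := if_neg hz
      rw [this]
      field_simp
  have step1 : ∑ x : Fin n → X, ∑ k, ∑ j,
        (keyCard R0 n : ℝ)⁻¹ * ((msgCard R n : ℝ)⁻¹ * WN j k x) * h x k j
      - B * ((keyCard R0 n : ℝ)⁻¹ * ∑ k, ∑ x : Fin n → X,
          |(msgCard R n : ℝ)⁻¹ * ∑ j, WN j k x - ∏ i, p0 (x i)|)
      ≤ avgValue p0 π S A := by
    have swap : ∑ k, ∑ x : Fin n → X, |(msgCard R n : ℝ)⁻¹ * ∑ j, WN j k x - ∏ i, p0 (x i)|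
        = ∑ x : Fin n → X, ∑ k, |(msgCard R n : ℝ)⁻¹ * ∑ j, WN j k x - ∏ i, p0 (x i)| :=
      Finset.sum_comm
    rw [value, sub_le_iff_le_add, ← sub_le_iff_le_add', swap,
      ← Finset.sum_sub_distrib, Finset.mul_sum, Finset.mul_sum]
    refine Finset.sum_le_sum fun x _ => ?_
    rw [← Finset.sum_sub_distrib, Finset.mul_sum, Finset.mul_sum]
    refine Finset.sum_le_sum fun k _ => ?_
    rw [← Finset.sum_sub_distrib]
    set s := (msgCard R n : ℝ)⁻¹ * ∑ j', WN j' k x with hs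
    calc _ = ∑ j, S.enc x k j * ((keyCard R0 n : ℝ)⁻¹ * ((s - ∏ i, p0 (x i)) * h x k j)) := by
          refine Finset.sum_congr rfl fun j _ => ?_
          rw [likelihood]; ring
      _ ≤ ∑ j, S.enc x k j * ((keyCard R0 n : ℝ)⁻¹ * (|s - ∏ i, p0 (x i)| * B)) := by
          refine Finset.sum_le_sum fun j _ => mul_le_mul_of_nonneg_left
            (mul_le_mul_of_nonneg_left ?_ (by positivity)) ((S.enc_pmf _ _).1 _)
          refine (le_abs_self _).trans ?_
          rw [abs_mul]
          exact mul_le_mul_of_nonneg_left (hhB _ _ _) (abs_nonneg _)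
      _ = _ := by rw [← Finset.sum_mul, (S.enc_pmf _ _).2]; ring
  have rearrange : ∑ x : Fin n → X, ∑ k, ∑ j,
        (keyCard R0 n : ℝ)⁻¹ * ((msgCard R n : ℝ)⁻¹ * WN j k x) * h x k j
      = (msgCard R n : ℝ)⁻¹ * ∑ j, ∑ ω : Fin n → X × Y,
          ((keyCard R0 n : ℝ)⁻¹ * ∑ k, ∏ i, (W (cu j i) (cv j k i) (ω i).1 *
            D (cu j i) (cv j k i) (ω i).2)) *
          advPayoff π A j (fun i => (ω i).1) fun i => (ω i).2 := by
    have e : ∀ j, ∑ ω : Fin n → X × Y,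
          ((keyCard R0 n : ℝ)⁻¹ * ∑ k, ∏ i, (W (cu j i) (cv j k i) (ω i).1 *
            D (cu j i) (cv j k i) (ω i).2)) *
          advPayoff π A j (fun i => (ω i).1) (fun i => (ω i).2)
        = ∑ x, ∑ y, ((keyCard R0 n : ℝ)⁻¹ * ∑ k, WN j k x * DN j k y) *
          advPayoff π A j x y := by
      intro j
      rw [sum_arrow_prod]
      simp only [hWN, hDN, Finset.prod_mul_distrib]
    simp_rw [e, hh]
    calc _ = ∑ x : Fin n → X, ∑ j, ∑ k,
        (keyCard R0 n : ℝ)⁻¹ * ((msgCard R n : ℝ)⁻¹ * WN j k x) *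
          ∑ y, DN j k y * advPayoff π A j x y :=
          Finset.sum_congr rfl fun x _ => Finset.sum_comm
      _ = _ := by
        rw [Finset.sum_comm, Finset.mul_sum]
        refine Finset.sum_congr rfl fun j _ => ?_
        rw [Finset.mul_sum]
        refine Finset.sum_congr rfl fun x _ => ?_
        simp_rw [Finset.mul_sum, Finset.sum_mul, Finset.mul_sum]
        rw [Finset.sum_comm]
        refine Finset.sum_congr rfl fun y _ => Finset.sum_congr rfl fun k _ => ?_
        ring
  have step2 : (msgCard R n : ℝ)⁻¹ * ∑ j, ((n : ℝ)⁻¹ * ∑ i, m (cu j i))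
      - B * ((msgCard R n : ℝ)⁻¹ * ∑ j, ∑ ω : Fin n → X × Y,
          |(keyCard R0 n : ℝ)⁻¹ * ∑ k, ∏ i, (W (cu j i) (cv j k i) (ω i).1 *
            D (cu j i) (cv j k i) (ω i).2) - ∏ i, E (cu j i) (ω i)|)
      ≤ ∑ x : Fin n → X, ∑ k, ∑ j,
        (keyCard R0 n : ℝ)⁻¹ * ((msgCard R n : ℝ)⁻¹ * WN j k x) * h x k j := by
    rw [rearrange, mul_left_comm, ← mul_sub, Finset.mul_sum Finset.univ _ B,
      ← Finset.sum_sub_distrib]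
    refine mul_le_mul_of_nonneg_left (Finset.sum_le_sum fun j _ => ?_) (by positivity)
    have ideal := average_le_sum_mul_advPayoff π A j (fun i => hE (cu j i)) (fun i => m (cu j i))
      (fun i z => hm _ z)
    rw [sub_le_iff_le_add]
    refine ideal.trans ?_
    rw [Finset.mul_sum, ← Finset.sum_add_distrib]
    refine Finset.sum_le_sum fun ω _ => ?_
    rw [← sub_le_iff_le_add', ← sub_mul]
    refine (le_abs_self _).trans ?_
    rw [abs_mul, abs_sub_comm, mul_comm]
    exact mul_le_mul_of_nonneg_right (abs_advPayoff_le hB0 hB A j _ _) (abs_nonneg _)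
  linarith [step1, step2]

end

/-! ### Random superposition codebooks -/

section

variable {U V : Type} [Fintype U] [Fintype V]

/-- The law of a random codeword `uᴺ` together with a family `(vᴺ(k))ₖ` of conditionally
independent satellite codewords. -/
def codewordPMF (qU : U → ℝ) (qV : U → V → ℝ) (κ : Type) [Fintype κ] (N : ℕ)
    (s : (Fin N → U) × (κ → Fin N → V)) : ℝ :=
  (∏ i, qU (s.1 i)) * ∏ k, ∏ i, qV (s.1 i) (s.2 k i)

variable {qU : U → ℝ} {qV : U → V → ℝ}

theorem isPMF_codewordPMF (hU : IsPMF qU) (hV : ∀ u, IsPMF (qV u)) (κ : Type) [Fintype κ]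
    [DecidableEq κ] (N : ℕ) : IsPMF (codewordPMF qU qV κ N) := by
  have h1 : ∀ u : Fin N → U, IsPMF fun v : κ → Fin N → V => ∏ k, ∏ i, qV (u i) (v k i) :=
    fun u => IsPMF.pi fun _ => IsPMF.pi fun i => hV (u i)
  refine ⟨fun s => mul_nonneg ((IsPMF.pi fun _ => hU).1 s.1) ((h1 s.1).1 s.2), ?_⟩
  rw [Fintype.sum_prod_type]
  simp only [codewordPMF, ← Finset.mul_sum, (h1 _).2, mul_one]
  exact (IsPMF.pi fun _ => hU).2

theorem sum_codewordPMF_mul_satellite (hV : ∀ u, IsPMF (qV u)) {κ : Type} [Fintype κ]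
    [DecidableEq κ] {N : ℕ} (k : κ) (F : (Fin N → U) → (Fin N → V) → ℝ) :
    ∑ s, codewordPMF qU qV κ N s * F s.1 (s.2 k)
      = ∑ θ : Fin N → U × V, (∏ i, qU (θ i).1 * qV (θ i).1 (θ i).2) *
          F (fun i => (θ i).1) fun i => (θ i).2 := by
  rw [Fintype.sum_prod_type]
  have e : ∀ u : Fin N → U, ∑ v, codewordPMF qU qV κ N (u, v) * F u (v k)
      = ∑ v : Fin N → V, (∏ i, qU (u i)) * (∏ i, qV (u i) (v i)) * F u v := by
    intro u
    have := sum_pi_mul_apply (fun _ : κ => IsPMF.pi fun i => hV (u i)) k (F u)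
    simp only [codewordPMF, mul_assoc, ← Finset.mul_sum]
    rw [this]
  simp_rw [e]
  rw [sum_arrow_prod]
  simp only [Finset.prod_mul_distrib]

theorem sum_codewordPMF_mul_center (hU : IsPMF qU) (hV : ∀ u, IsPMF (qV u)) {κ : Type} [Fintype κ]
    [DecidableEq κ] {N : ℕ} (i : Fin N) (f : U → ℝ) :
    ∑ s, codewordPMF qU qV κ N s * f (s.1 i) = ∑ u, qU u * f u := by
  rw [Fintype.sum_prod_type]
  have e : ∀ u : Fin N → U, ∑ v, codewordPMF qU qV κ N (u, v) * f (u i)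
      = (∏ i, qU (u i)) * f (u i) := by
    intro u
    rw [← Finset.sum_mul]
    simp only [codewordPMF, ← Finset.mul_sum]
    rw [(IsPMF.pi fun _ : κ => IsPMF.pi fun i => hV (u i)).2, mul_one]
  simp_rw [e]
  exact sum_pi_mul_apply (fun _ : Fin N => hU) i f

theorem expected_source_covering_le {X : Type} [Fintype X] (hU : IsPMF qU)
    (hV : ∀ u, IsPMF (qV u)) {W : U → V → X → ℝ} (hW : ∀ u v, IsPMF (W u v)) {p0 : X → ℝ}
    (hp0 : IsPMF p0) (hmarg : ∀ x, ∑ u, ∑ v, qU u * qV u v * W u v x = p0 x)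
    {ι κ : Type} [Fintype ι] [DecidableEq ι] [Nonempty ι] [Fintype κ] [DecidableEq κ] {N : ℕ}
    (k : κ) {τ : ℝ} (hτ : 0 ≤ τ) :
    ∑ c : ι → (Fin N → U) × (κ → Fin N → V), (∏ j, codewordPMF qU qV κ N (c j)) *
        ∑ x : Fin N → X, |(Fintype.card ι : ℝ)⁻¹ *
          ∑ j, ∏ i, W ((c j).1 i) ((c j).2 k i) (x i) - ∏ i, p0 (x i)|
      ≤ 2 * (∑ θ : Fin N → (U × V) × X,
          if τ * ∏ i, p0 (θ i).2 < ∏ i, W (θ i).1.1 (θ i).1.2 (θ i).2 then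
            ∏ i, (qU (θ i).1.1 * qV (θ i).1.1 (θ i).1.2 * W (θ i).1.1 (θ i).1.2 (θ i).2) else 0)
        + √(τ / Fintype.card ι) := by
  have hsc := soft_covering (ι := ι) (isPMF_codewordPMF hU hV κ N)
    (fun s (x : Fin N → X) => ∏ i, W (s.1 i) (s.2 k i) (x i))
    (fun s x => Finset.prod_nonneg fun i _ => (hW _ _).1 _) (fun x => ∏ i, p0 (x i)) ?_
    (IsPMF.pi fun _ => hp0).2 τ hτ
  · refine hsc.trans (le_of_eq ?_)
    congr 2
    have := sum_codewordPMF_mul_satellite (qU := qU) hV k (fun u v => ∑ x : Fin N → X,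
      if τ * ∏ i, p0 (x i) < ∏ i, W (u i) (v i) (x i) then ∏ i, W (u i) (v i) (x i) else 0)
    simp only [Finset.mul_sum, mul_ite, mul_zero] at this
    rw [this, sum_arrow_prod (fun (θ : Fin N → U × V) (x : Fin N → X) =>
      if τ * ∏ i, p0 (x i) < ∏ i, W (θ i).1 (θ i).2 (x i) then
        (∏ i, qU (θ i).1 * qV (θ i).1 (θ i).2) * ∏ i, W (θ i).1 (θ i).2 (x i) else 0)]
    simp only [Finset.prod_mul_distrib]
  · intro x
    rw [sum_codewordPMF_mul_satellite hV k (fun u v => ∏ i, W (u i) (v i) (x i))]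
    simp_rw [← Finset.prod_mul_distrib]
    rw [sum_pi_prod (fun i (a : U × V) => qU a.1 * qV a.1 a.2 * W a.1 a.2 (x i))]
    refine Finset.prod_congr rfl fun i _ => ?_
    rw [Fintype.sum_prod_type, hmarg]

theorem expected_action_covering_le {O : Type} [Fintype O] (hU : IsPMF qU)
    (hV : ∀ u, IsPMF (qV u)) {T : U → V → O → ℝ} (hT : ∀ u v, IsPMF (T u v))
    {κ : Type} [Fintype κ] [DecidableEq κ] [Nonempty κ] {N : ℕ} {τ : ℝ} (hτ : 0 ≤ τ) :
    ∑ s, codewordPMF qU qV κ N s * ∑ ω : Fin N → O, |(Fintype.card κ : ℝ)⁻¹ *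
        ∑ k, ∏ i, T (s.1 i) (s.2 k i) (ω i) - ∏ i, ∑ v, qV (s.1 i) v * T (s.1 i) v (ω i)|
      ≤ 2 * (∑ θ : Fin N → (U × V) × O,
          if τ * ∏ i, ∑ v, qV (θ i).1.1 v * T (θ i).1.1 v (θ i).2
              < ∏ i, T (θ i).1.1 (θ i).1.2 (θ i).2 then
            ∏ i, (qU (θ i).1.1 * qV (θ i).1.1 (θ i).1.2 * T (θ i).1.1 (θ i).1.2 (θ i).2) else 0)
        + √(τ / Fintype.card κ) := by
  rw [Fintype.sum_prod_type]
  have hUN := IsPMF.pi fun _ : Fin N => hU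
  have key : ∀ u : Fin N → U, ∑ v, codewordPMF qU qV κ N (u, v) *
      ∑ ω : Fin N → O, |(Fintype.card κ : ℝ)⁻¹ *
        ∑ k, ∏ i, T (u i) (v k i) (ω i) - ∏ i, ∑ v, qV (u i) v * T (u i) v (ω i)|
      ≤ 2 * ((∏ i, qU (u i)) * ∑ v : Fin N → V, ∑ ω : Fin N → O,
          if τ * ∏ i, ∑ v, qV (u i) v * T (u i) v (ω i) < ∏ i, T (u i) (v i) (ω i) then
            (∏ i, qV (u i) (v i)) * ∏ i, T (u i) (v i) (ω i) else 0)
        + (∏ i, qU (u i)) * √(τ / Fintype.card κ) := by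
    intro u
    have hE : ∀ i, IsPMF fun o => ∑ v, qV (u i) v * T (u i) v o := by
      intro i
      refine ⟨fun o => Finset.sum_nonneg fun v _ => mul_nonneg ((hV _).1 _) ((hT _ _).1 _), ?_⟩
      rw [Finset.sum_comm]
      simp_rw [← Finset.mul_sum, (hT _ _).2, mul_one, (hV _).2]
    have hsc := soft_covering (ι := κ) (IsPMF.pi fun i => hV (u i))
      (fun (v : Fin N → V) (ω : Fin N → O) => ∏ i, T (u i) (v i) (ω i))
      (fun v ω => Finset.prod_nonneg fun i _ => (hT _ _).1 _)
      (fun ω => ∏ i, ∑ v, qV (u i) v * T (u i) v (ω i)) ?_ (IsPMF.pi hE).2 τ hτ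
    · have := mul_le_mul_of_nonneg_left hsc (hUN.1 u)
      simp only [codewordPMF, mul_assoc]
      rw [← Finset.mul_sum]
      refine this.trans (le_of_eq ?_)
      ring
    · intro ω
      simp_rw [← Finset.prod_mul_distrib]
      exact sum_pi_prod (fun i a => qV (u i) a * T (u i) a (ω i))
  refine (Finset.sum_le_sum fun u _ => key u).trans (le_of_eq ?_)
  rw [Finset.sum_add_distrib, ← Finset.sum_mul, hUN.2, one_mul, ← Finset.mul_sum]
  congr 2
  simp_rw [Finset.mul_sum, mul_ite, mul_zero]
  rw [sum_arrow_prod (fun (u : Fin N → U) (v : Fin N → V) => ∑ ω : Fin N → O,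
      if τ * ∏ i, ∑ v, qV (u i) v * T (u i) v (ω i) < ∏ i, T (u i) (v i) (ω i) then
        (∏ i, qU (u i)) * ((∏ i, qV (u i) (v i)) * ∏ i, T (u i) (v i) (ω i)) else 0),
    sum_arrow_prod (fun (θ : Fin N → U × V) (ω : Fin N → O) =>
      if τ * ∏ i, ∑ v, qV (θ i).1 v * T (θ i).1 v (ω i) < ∏ i, T (θ i).1 (θ i).2 (ω i) then
        (∏ i, qU (θ i).1) * ((∏ i, qV (θ i).1 (θ i).2) * ∏ i, T (θ i).1 (θ i).2 (ω i)) else 0)]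
  simp only [Finset.prod_mul_distrib, mul_assoc]

/-! ### Asymptotics of the covering errors -/

theorem half_rpow_le_msgCard (R : ℝ) (N : ℕ) :
    Real.exp (N * (R * Real.log 2)) / 2 ≤ msgCard R N := by
  have e : (2 : ℝ) ^ ((N : ℝ) * R) = Real.exp (N * (R * Real.log 2)) := by
    rw [Real.rpow_def_of_pos two_pos]; congr 1; ring
  have h1 := Nat.lt_floor_add_one ((2 : ℝ) ^ ((N : ℝ) * R))
  have h2 : ((⌊(2 : ℝ) ^ ((N : ℝ) * R)⌋₊ : ℕ) : ℝ) ≤ msgCard R N := by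
    exact_mod_cast le_max_right _ _
  have h3 : (1 : ℝ) ≤ msgCard R N := by exact_mod_cast msgCard_pos R N
  rw [e] at h1 h2
  linarith

theorem msgCard_le_rpow {R : ℝ} (hR : 0 ≤ R) (N : ℕ) :
    (msgCard R N : ℝ) ≤ Real.exp (N * (R * Real.log 2)) := by
  have e : (2 : ℝ) ^ ((N : ℝ) * R) = Real.exp (N * (R * Real.log 2)) := by
    rw [Real.rpow_def_of_pos two_pos]; congr 1; ring
  have h1 : (1 : ℝ) ≤ Real.exp (N * (R * Real.log 2)) :=
    Real.one_le_exp (by have := Real.log_pos one_lt_two; positivity)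
  rw [msgCard, Nat.cast_max, e]
  exact max_le (by exact_mod_cast h1) (Nat.floor_le (Real.exp_pos _).le)

theorem eventually_covering_error_le {I R : ℝ} (C : ℝ) (h : I < R * Real.log 2) {η : ℝ}
    (hη : 0 < η) : ∀ᶠ N : ℕ in Filter.atTop,
      2 * (C / N) + √(Real.exp (N * (I + (R * Real.log 2 - I) / 2)) / msgCard R N) ≤ η := by
  set δ := (R * Real.log 2 - I) / 2 with hδ
  have hδ0 : 0 < δ := by rw [hδ]; linarith
  have hlim : Filter.Tendsto (fun N : ℕ => 2 * (C / N) + √(2 * Real.exp (-(δ * N))))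
      Filter.atTop (nhds 0) := by
    have h1 : Filter.Tendsto (fun N : ℕ => C / (N : ℝ)) Filter.atTop (nhds 0) :=
      tendsto_const_div_atTop_nhds_zero_nat C
    have h2 : Filter.Tendsto (fun N : ℕ => Real.exp (-(δ * N))) Filter.atTop (nhds 0) :=
      Real.tendsto_exp_neg_atTop_nhds_zero.comp
        (tendsto_natCast_atTop_atTop.const_mul_atTop hδ0)
    have h3 := (h1.const_mul 2).add (h2.const_mul 2).sqrt
    simpa using h3
  filter_upwards [hlim.eventually (gt_mem_nhds hη)] with N hN
  refine le_trans ?_ hN.le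
  gcongr
  have hM : (0 : ℝ) < msgCard R N := by exact_mod_cast msgCard_pos R N
  rw [div_le_iff₀ hM]
  have e : Real.exp (N * (I + δ)) = Real.exp (-(δ * N)) * Real.exp (N * (R * Real.log 2)) := by
    rw [← Real.exp_add]; congr 1; rw [hδ]; ring
  rw [e]
  have := mul_le_mul_of_nonneg_left (half_rpow_le_msgCard R N) (Real.exp_pos (-(δ * N))).le
  linarith

end

/-! ### Achievability of single-letter values -/

section

variable {U V : Type} [Fintype U] [Fintype V] {qU : U → ℝ} {qV : U → V → ℝ}

theorem IsPMF.compProd {α β : Type} [Fintype α] [Fintype β] {p : α → ℝ} (hp : IsPMF p)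
    {κ : α → β → ℝ} (hκ : ∀ a, IsPMF (κ a)) : IsPMF fun t : α × β => p t.1 * κ t.1 t.2 := by
  refine ⟨fun t => mul_nonneg (hp.1 _) ((hκ _).1 _), ?_⟩
  rw [Fintype.sum_prod_type]
  simp_rw [← Finset.mul_sum, (hκ _).2, mul_one, hp.2]

theorem eventually_expected_source_error_le {X : Type} [Fintype X] (hU : IsPMF qU)
    (hV : ∀ u, IsPMF (qV u)) {W : U → V → X → ℝ} (hW : ∀ u v, IsPMF (W u v)) {p0 : X → ℝ}
    (hp0 : IsPMF p0) (hmarg : ∀ x, ∑ u, ∑ v, qU u * qV u v * W u v x = p0 x) {R : ℝ}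
    (hR : (∑ θ : (U × V) × X, qU θ.1.1 * qV θ.1.1 θ.1.2 * W θ.1.1 θ.1.2 θ.2 *
        Real.log (W θ.1.1 θ.1.2 θ.2 / p0 θ.2) < R * Real.log 2) ∨ ∀ u v, W u v = p0)
    {η : ℝ} (hη : 0 < η) : ∀ᶠ N : ℕ in Filter.atTop, ∀ (κ : Type) [Fintype κ] [DecidableEq κ]
      (k : κ), ∑ c : Fin (msgCard R N) → (Fin N → U) × (κ → Fin N → V),
        (∏ j, codewordPMF qU qV κ N (c j)) * ∑ x : Fin N → X, |(msgCard R N : ℝ)⁻¹ *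
          ∑ j, ∏ i, W ((c j).1 i) ((c j).2 k i) (x i) - ∏ i, p0 (x i)| ≤ η := by
  rcases hR with hR | hR
  · have hρ : IsPMF fun θ : (U × V) × X =>
        qU θ.1.1 * qV θ.1.1 θ.1.2 * W θ.1.1 θ.1.2 θ.2 :=
      (hU.compProd hV).compProd fun t => hW t.1 t.2
    obtain ⟨C, hC⟩ := exists_iid_tail_bound hρ (fun θ => W θ.1.1 θ.1.2 θ.2) (fun θ => p0 θ.2) (by
      rintro ⟨⟨u, v⟩, x⟩ h
      have h1 : 0 < qU u * qV u v * W u v x := lt_of_le_of_ne (hρ.1 ((u, v), x)) (Ne.symm h)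
      refine ⟨lt_of_le_of_ne ((hW u v).1 x) (Ne.symm (right_ne_zero_of_mul h)), ?_⟩
      rw [← hmarg x]
      have h0 : ∀ u v, 0 ≤ qU u * qV u v * W u v x := fun u v => hρ.1 ((u, v), x)
      exact h1.trans_le ((Finset.single_le_sum (fun v _ => h0 u v) (Finset.mem_univ v)).trans
        (Finset.single_le_sum (f := fun u => ∑ v, qU u * qV u v * W u v x)
          (fun u _ => Finset.sum_nonneg fun v _ => h0 u v) (Finset.mem_univ u)))) _ rfl
      (half_pos (sub_pos.2 hR))
    filter_upwards [eventually_covering_error_le C hR hη, Filter.eventually_gt_atTop 0]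
      with N hN hN0 κ _ _ k
    refine le_trans ?_ hN
    have := expected_source_covering_le (ι := Fin (msgCard R N)) (N := N) hU hV hW hp0 hmarg k
      (Real.exp_pos (N * ((∑ θ : (U × V) × X, qU θ.1.1 * qV θ.1.1 θ.1.2 * W θ.1.1 θ.1.2 θ.2 *
        Real.log (W θ.1.1 θ.1.2 θ.2 / p0 θ.2)) + (R * Real.log 2 - ∑ θ : (U × V) × X,
          qU θ.1.1 * qV θ.1.1 θ.1.2 * W θ.1.1 θ.1.2 θ.2 *
        Real.log (W θ.1.1 θ.1.2 θ.2 / p0 θ.2)) / 2))).le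
    rw [Fintype.card_fin] at this
    refine this.trans ?_
    gcongr
    exact hC N hN0
  · refine Filter.Eventually.of_forall fun N κ _ _ k => ?_
    have hM : (msgCard R N : ℝ) ≠ 0 := by exact_mod_cast (msgCard_pos R N).ne'
    simp [hR, hM, hη.le]

theorem eventually_expected_action_error_le {O : Type} [Fintype O] (hU : IsPMF qU)
    (hV : ∀ u, IsPMF (qV u)) {T : U → V → O → ℝ} (hT : ∀ u v, IsPMF (T u v)) {R0 : ℝ}
    (hR0 : (∑ θ : (U × V) × O, qU θ.1.1 * qV θ.1.1 θ.1.2 * T θ.1.1 θ.1.2 θ.2 *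
        Real.log (T θ.1.1 θ.1.2 θ.2 / ∑ v, qV θ.1.1 v * T θ.1.1 v θ.2) < R0 * Real.log 2)
      ∨ Subsingleton V)
    {η : ℝ} (hη : 0 < η) : ∀ᶠ N : ℕ in Filter.atTop,
      ∑ s, codewordPMF qU qV (Fin (keyCard R0 N)) N s * ∑ ω : Fin N → O,
        |(keyCard R0 N : ℝ)⁻¹ * ∑ k, ∏ i, T (s.1 i) (s.2 k i) (ω i)
          - ∏ i, ∑ v, qV (s.1 i) v * T (s.1 i) v (ω i)| ≤ η := by
  rcases hR0 with hR0 | hR0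
  · have hρ : IsPMF fun θ : (U × V) × O =>
        qU θ.1.1 * qV θ.1.1 θ.1.2 * T θ.1.1 θ.1.2 θ.2 :=
      (hU.compProd hV).compProd fun t => hT t.1 t.2
    obtain ⟨C, hC⟩ := exists_iid_tail_bound hρ (fun θ => T θ.1.1 θ.1.2 θ.2)
      (fun θ => ∑ v, qV θ.1.1 v * T θ.1.1 v θ.2) (by
      rintro ⟨⟨u, v⟩, o⟩ h
      have h2 : T u v o ≠ 0 := right_ne_zero_of_mul h
      have h3 : qV u v ≠ 0 := right_ne_zero_of_mul (left_ne_zero_of_mul h)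
      have h4 : 0 < T u v o := lt_of_le_of_ne ((hT u v).1 o) h2.symm
      have h5 : 0 < qV u v := lt_of_le_of_ne ((hV u).1 v) h3.symm
      refine ⟨h4, (mul_pos h5 h4).trans_le ?_⟩
      exact Finset.single_le_sum (f := fun v => qV u v * T u v o)
        (fun v _ => mul_nonneg ((hV u).1 v) ((hT u v).1 o)) (Finset.mem_univ v)) _ rfl
      (half_pos (sub_pos.2 hR0))
    filter_upwards [eventually_covering_error_le C hR0 hη, Filter.eventually_gt_atTop 0]
      with N hN hN0
    refine le_trans ?_ hN
    have := expected_action_covering_le (κ := Fin (keyCard R0 N)) (N := N) hU hV hT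
      (Real.exp_pos (N * ((∑ θ : (U × V) × O, qU θ.1.1 * qV θ.1.1 θ.1.2 * T θ.1.1 θ.1.2 θ.2 *
        Real.log (T θ.1.1 θ.1.2 θ.2 / ∑ v, qV θ.1.1 v * T θ.1.1 v θ.2)) + (R0 * Real.log 2 -
          ∑ θ : (U × V) × O, qU θ.1.1 * qV θ.1.1 θ.1.2 * T θ.1.1 θ.1.2 θ.2 *
        Real.log (T θ.1.1 θ.1.2 θ.2 / ∑ v, qV θ.1.1 v * T θ.1.1 v θ.2)) / 2))).le
    rw [Fintype.card_fin] at this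
    refine this.trans (add_le_add (mul_le_mul_of_nonneg_left (hC N hN0) two_pos.le) le_rfl)
  · refine Filter.Eventually.of_forall fun N => ?_
    have hL : (keyCard R0 N : ℝ) ≠ 0 := by exact_mod_cast (keyCard_pos R0 N).ne'
    refine (Finset.sum_eq_zero fun s _ => ?_).le.trans hη.le
    refine mul_eq_zero_of_right _ (Finset.sum_eq_zero fun ω _ => ?_)
    have e1 : ∀ k i, T (s.1 i) (s.2 k i) (ω i) = ∑ v, qV (s.1 i) v * T (s.1 i) v (ω i) := by
      intro k i
      have : ∀ v, qV (s.1 i) v * T (s.1 i) v (ω i)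
          = qV (s.1 i) v * T (s.1 i) (s.2 k i) (ω i) := fun v => by
        rw [Subsingleton.elim v (s.2 k i)]
      simp_rw [this, ← Finset.sum_mul, (hV _).2, one_mul]
    simp only [e1, Finset.sum_const, Finset.card_univ, Fintype.card_fin, nsmul_eq_mul]
    rw [inv_mul_cancel_left₀ hL, sub_self, abs_zero]

theorem exists_le_of_sum_mul_le {α : Type} [Fintype α] {p : α → ℝ} (h : IsPMF p) {f : α → ℝ}
    {c : ℝ} (hc : c ≤ ∑ a, p a * f a) : ∃ a, c ≤ f a := by
  by_contra! hlt
  have h1 : ∑ a, p a * f a < ∑ a, p a * c := by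
    obtain ⟨a, ha⟩ : ∃ a, p a ≠ 0 := by
      by_contra! h0
      have := h.2
      simp [h0] at this
    exact Finset.sum_lt_sum (fun b _ => mul_le_mul_of_nonneg_left (hlt b).le (h.1 b))
      ⟨a, Finset.mem_univ a, mul_lt_mul_of_pos_left (hlt a) (lt_of_le_of_ne (h.1 a) ha.symm)⟩
  rw [← Finset.sum_mul, h.2, one_mul] at h1
  linarith

theorem exists_memoryless_of_strict {X Y Z : Type} [Fintype X] [Fintype Y] [Fintype Z]
    [Nonempty X] [Nonempty Y] [Nonempty Z] (hU : IsPMF qU)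
    (hV : ∀ u, IsPMF (qV u)) {W : U → V → X → ℝ} (hW : ∀ u v, IsPMF (W u v))
    {D : U → V → Y → ℝ} (hD : ∀ u v, IsPMF (D u v)) {p0 : X → ℝ}
    (hp0 : IsPMF p0) (π : X → Y → Z → ℝ)
    (hmarg : ∀ x, ∑ u, ∑ v, qU u * qV u v * W u v x = p0 x) {R0 R : ℝ}
    (hR : (∑ θ : (U × V) × X, qU θ.1.1 * qV θ.1.1 θ.1.2 * W θ.1.1 θ.1.2 θ.2 *
        Real.log (W θ.1.1 θ.1.2 θ.2 / p0 θ.2) < R * Real.log 2) ∨ ∀ u v, W u v = p0)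
    (hR0 : (∑ θ : (U × V) × (X × Y),
        qU θ.1.1 * qV θ.1.1 θ.1.2 * (W θ.1.1 θ.1.2 θ.2.1 * D θ.1.1 θ.1.2 θ.2.2) *
        Real.log ((W θ.1.1 θ.1.2 θ.2.1 * D θ.1.1 θ.1.2 θ.2.2) /
          ∑ v, qV θ.1.1 v * (W θ.1.1 v θ.2.1 * D θ.1.1 v θ.2.2)) < R0 * Real.log 2)
      ∨ Subsingleton V)
    {ε : ℝ} (hε : 0 < ε) (m : U → ℝ)
    (hm : ∀ u z, m u ≤ ∑ a : X × Y, (∑ v, qV u v * (W u v a.1 * D u v a.2)) * π a.1 a.2 z) :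
    ∃ (N : ℕ) (_ : 0 < N) (S : Scheme X Y Z R0 R N), MemorylessDecoder S ∧
      ∀ A, ∑ u, qU u * m u - ε ≤ avgValue p0 π S A := by
  obtain ⟨B, hB0, hB⟩ := exists_abs_payoff_le π
  set η := ε / (2 * (B + 1)) with hηdef
  have hη : 0 < η := by positivity
  have hT : ∀ u v, IsPMF fun a : X × Y => W u v a.1 * D u v a.2 := fun u v =>
    (hW u v).compProd fun _ => hD u v
  have hE : ∀ u, IsPMF fun a : X × Y => ∑ v, qV u v * (W u v a.1 * D u v a.2) := by
    intro u
    refine ⟨fun o => Finset.sum_nonneg fun v _ => mul_nonneg ((hV _).1 _) ((hT _ _).1 _), ?_⟩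
    rw [Finset.sum_comm]
    simp_rw [← Finset.mul_sum, (hT _ _).2, mul_one, (hV _).2]
  obtain ⟨N, h1, h2, hN⟩ := ((eventually_expected_source_error_le hU hV hW hp0 hmarg hR hη).and
    ((eventually_expected_action_error_le hU hV hT hR0 hη).and
      (Filter.eventually_gt_atTop 0))).exists
  have hM : (msgCard R N : ℝ) ≠ 0 := by exact_mod_cast (msgCard_pos R N).ne'
  have hL : (keyCard R0 N : ℝ) ≠ 0 := by exact_mod_cast (keyCard_pos R0 N).ne'
  have hN' : (N : ℝ) ≠ 0 := by exact_mod_cast hN.ne'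
  have hq := isPMF_codewordPMF hU hV (Fin (keyCard R0 N)) N
  have hc := IsPMF.pi fun _ : Fin (msgCard R N) => hq
  have hval : ∑ c : Fin (msgCard R N) → (Fin N → U) × (Fin (keyCard R0 N) → Fin N → V),
      (∏ j, codewordPMF qU qV (Fin (keyCard R0 N)) N (c j)) *
        ((msgCard R N : ℝ)⁻¹ * ∑ j, ((N : ℝ)⁻¹ * ∑ i, m ((c j).1 i))) = ∑ u, qU u * m u := by
    have e : ∀ (j : Fin (msgCard R N)),
        ∑ c : Fin (msgCard R N) → (Fin N → U) × (Fin (keyCard R0 N) → Fin N → V),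
          (∏ j, codewordPMF qU qV (Fin (keyCard R0 N)) N (c j)) *
            ((N : ℝ)⁻¹ * ∑ i, m ((c j).1 i)) = ∑ u, qU u * m u := by
      intro j
      rw [sum_pi_mul_apply (fun _ : Fin (msgCard R N) => hq) j
        fun s => (N : ℝ)⁻¹ * ∑ i, m (s.1 i)]
      simp_rw [mul_left_comm _ (N : ℝ)⁻¹, Finset.mul_sum]
      rw [Finset.sum_comm]
      simp_rw [← Finset.mul_sum, sum_codewordPMF_mul_center hU hV]
      simp [hN']
    simp_rw [mul_left_comm _ (msgCard R N : ℝ)⁻¹, Finset.mul_sum Finset.univ _ (∏ j, _)]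
    rw [← Finset.mul_sum, Finset.sum_comm]
    simp_rw [e]
    simp [hM]
  have herr1 : ∑ c : Fin (msgCard R N) → (Fin N → U) × (Fin (keyCard R0 N) → Fin N → V),
      (∏ j, codewordPMF qU qV (Fin (keyCard R0 N)) N (c j)) *
        ((keyCard R0 N : ℝ)⁻¹ * ∑ k, ∑ x : Fin N → X, |(msgCard R N : ℝ)⁻¹ *
          ∑ j, ∏ i, W ((c j).1 i) ((c j).2 k i) (x i) - ∏ i, p0 (x i)|) ≤ η := by
    simp_rw [mul_left_comm _ (keyCard R0 N : ℝ)⁻¹,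
      Finset.mul_sum (Finset.univ : Finset (Fin (keyCard R0 N))) _ (∏ j, _)]
    rw [← Finset.mul_sum, Finset.sum_comm]
    refine (mul_le_mul_of_nonneg_left (Finset.sum_le_sum fun k _ =>
      h1 (Fin (keyCard R0 N)) k) (by positivity)).trans ?_
    simp [hL]
  have herr2 : ∑ c : Fin (msgCard R N) → (Fin N → U) × (Fin (keyCard R0 N) → Fin N → V),
      (∏ j, codewordPMF qU qV (Fin (keyCard R0 N)) N (c j)) *
        ((msgCard R N : ℝ)⁻¹ * ∑ j, ∑ ω : Fin N → X × Y, |(keyCard R0 N : ℝ)⁻¹ *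
          ∑ k, ∏ i, (W ((c j).1 i) ((c j).2 k i) (ω i).1 * D ((c j).1 i) ((c j).2 k i) (ω i).2)
          - ∏ i, ∑ v, qV ((c j).1 i) v * (W ((c j).1 i) v (ω i).1 * D ((c j).1 i) v (ω i).2)|)
        ≤ η := by
    simp_rw [mul_left_comm _ (msgCard R N : ℝ)⁻¹,
      Finset.mul_sum (Finset.univ : Finset (Fin (msgCard R N))) _ (∏ j, _)]
    rw [← Finset.mul_sum, Finset.sum_comm]
    refine (mul_le_mul_of_nonneg_left (Finset.sum_le_sum fun j _ =>
      (sum_pi_mul_apply (fun _ : Fin (msgCard R N) => hq) j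
        fun s => ∑ ω : Fin N → X × Y, |(keyCard R0 N : ℝ)⁻¹ *
          ∑ k, ∏ i, (W (s.1 i) (s.2 k i) (ω i).1 * D (s.1 i) (s.2 k i) (ω i).2)
          - ∏ i, ∑ v, qV (s.1 i) v * (W (s.1 i) v (ω i).1 * D (s.1 i) v (ω i).2)|).le.trans h2)
      (by positivity)).trans ?_
    simp [hM]
  obtain ⟨c, hcbound⟩ := exists_le_of_sum_mul_le hc (c := ∑ u, qU u * m u - B * η - B * η)
    (f := fun c => (msgCard R N : ℝ)⁻¹ * ∑ j, ((N : ℝ)⁻¹ * ∑ i, m ((c j).1 i))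
      - B * ((keyCard R0 N : ℝ)⁻¹ * ∑ k, ∑ x : Fin N → X, |(msgCard R N : ℝ)⁻¹ *
          ∑ j, ∏ i, W ((c j).1 i) ((c j).2 k i) (x i) - ∏ i, p0 (x i)|)
      - B * ((msgCard R N : ℝ)⁻¹ * ∑ j, ∑ ω : Fin N → X × Y, |(keyCard R0 N : ℝ)⁻¹ *
          ∑ k, ∏ i, (W ((c j).1 i) ((c j).2 k i) (ω i).1 * D ((c j).1 i) ((c j).2 k i) (ω i).2)
          - ∏ i, ∑ v, qV ((c j).1 i) v * (W ((c j).1 i) v (ω i).1 * D ((c j).1 i) v (ω i).2)|))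
    (by
      simp_rw [mul_sub, Finset.sum_sub_distrib, mul_left_comm _ B, ← Finset.mul_sum _ _ B]
      rw [hval]
      gcongr)
  refine ⟨N, hN, codeScheme hW hD (fun j => (c j).1) (fun j => (c j).2),
    fun _ _ _ _ _ _ _ _ _ => rfl, fun A => ?_⟩
  refine le_trans ?_ (hcbound.trans
    (le_avgValue_codeScheme p0 hB0 hB hW hD hE m hm (fun j => (c j).1) (fun j => (c j).2) A))
  have : 2 * (B * η) ≤ ε := by
    rw [hηdef, ← mul_assoc, mul_div_assoc', div_le_iff₀ (by positivity)]
    nlinarith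
  linarith

end

section

variable {U V : Type} [Fintype U] [Fintype V] {qU : U → ℝ} {qV : U → V → ℝ}

theorem log_div_self_eq_zero (a : ℝ) : Real.log (a / a) = 0 := by
  rcases eq_or_ne a 0 with rfl | h
  · simp
  · rw [div_self h, Real.log_one]

theorem IsPMF.exists_pos {α : Type} [Fintype α] {p : α → ℝ} (h : IsPMF p) : ∃ a, 0 < p a := by
  by_contra! h0
  have : ∑ a, p a ≤ 0 := Finset.sum_nonpos fun a _ => h0 a
  rw [h.2] at this
  linarith

/-- Mixing in, with small probability, an auxiliary symbol that makes the actions independent of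
everything removes the need for strict inequalities in the rate constraints. -/
theorem exists_memoryless_of_le {X Y Z : Type} [Fintype X] [Fintype Y] [Fintype Z]
    [Nonempty X] [Nonempty Y] [Nonempty Z] (hU : IsPMF qU)
    (hV : ∀ u, IsPMF (qV u)) {W : U → V → X → ℝ} (hW : ∀ u v, IsPMF (W u v))
    {D : U → V → Y → ℝ} (hD : ∀ u v, IsPMF (D u v)) {p0 : X → ℝ}
    (hp0 : IsPMF p0) (π : X → Y → Z → ℝ)
    (hmarg : ∀ x, ∑ u, ∑ v, qU u * qV u v * W u v x = p0 x) {R0 R : ℝ}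
    (hR : (0 < R ∧ ∑ θ : (U × V) × X, qU θ.1.1 * qV θ.1.1 θ.1.2 * W θ.1.1 θ.1.2 θ.2 *
        Real.log (W θ.1.1 θ.1.2 θ.2 / p0 θ.2) ≤ R * Real.log 2) ∨ ∀ u v, W u v = p0)
    (hR0 : (0 < R0 ∧ ∑ θ : (U × V) × (X × Y),
        qU θ.1.1 * qV θ.1.1 θ.1.2 * (W θ.1.1 θ.1.2 θ.2.1 * D θ.1.1 θ.1.2 θ.2.2) *
        Real.log ((W θ.1.1 θ.1.2 θ.2.1 * D θ.1.1 θ.1.2 θ.2.2) /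
          ∑ v, qV θ.1.1 v * (W θ.1.1 v θ.2.1 * D θ.1.1 v θ.2.2)) ≤ R0 * Real.log 2)
      ∨ Subsingleton V)
    {ε : ℝ} (hε : 0 < ε) (m : U → ℝ)
    (hm : ∀ u z, m u ≤ ∑ a : X × Y, (∑ v, qV u v * (W u v a.1 * D u v a.2)) * π a.1 a.2 z) :
    ∃ (N : ℕ) (_ : 0 < N) (S : Scheme X Y Z R0 R N), MemorylessDecoder S ∧
      ∀ A, ∑ u, qU u * m u - ε ≤ avgValue p0 π S A := by
  obtain ⟨B, hB0, hB⟩ := exists_abs_payoff_le π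
  obtain ⟨u₀, -⟩ := hU.exists_pos
  obtain ⟨y₀⟩ := ‹Nonempty Y›
  set γ := ∑ u, qU u * m u with hγ
  set t := (ε / 2) / (|γ| + B + 1 + ε) with ht
  have hγ0 := abs_nonneg γ
  have ht0 : 0 < t := by positivity
  have ht1 : t < 1 := by
    rw [ht, div_lt_one (by positivity)]; linarith
  have htε : t * (|γ| + B) ≤ ε / 2 := by
    rw [ht, div_mul_eq_mul_div, div_le_iff₀ (by positivity)]
    nlinarith
  have hlog := Real.log_pos one_lt_two
  set qU' : Option U → ℝ := fun o => o.elim t fun u => (1 - t) * qU u with hqU'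
  set qV' : Option U → V → ℝ := fun o => o.elim (qV u₀) qV with hqV'
  set W' : Option U → V → X → ℝ := fun o => o.elim (fun _ => p0) W with hW'
  set D' : Option U → V → Y → ℝ := fun o => o.elim (fun _ y => if y = y₀ then 1 else 0) D
    with hD'
  set m' : Option U → ℝ := fun o => o.elim (-B) m with hm'
  have pV : ∀ o, IsPMF (qV' o) := by rintro (_ | u); exacts [hV _, hV _]
  have pW : ∀ o v, IsPMF (W' o v) := by rintro (_ | u) v; exacts [hp0, hW _ _]
  have pD : ∀ o v, IsPMF (D' o v) := by rintro (_ | u) v; exacts [isPMF_ite_eq y₀, hD _ _]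
  have pU : IsPMF qU' := by
    refine ⟨?_, ?_⟩
    · rintro (_ | u)
      exacts [ht0.le, mul_nonneg (by linarith) (hU.1 u)]
    · rw [Fintype.sum_option]
      simp only [hqU', Option.elim, ← Finset.mul_sum, hU.2]
      ring
  have scale : ∀ {c I : ℝ}, 0 < c → I ≤ c → (1 - t) * I < c := fun {c I} hc hI => by
    nlinarith
  suffices h : ∃ (N : ℕ) (_ : 0 < N) (S : Scheme X Y Z R0 R N), MemorylessDecoder S ∧
      ∀ A, ∑ o, qU' o * m' o - ε / 2 ≤ avgValue p0 π S A by
    obtain ⟨N, hN, S, hS, hval⟩ := h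
    refine ⟨N, hN, S, hS, fun A => le_trans ?_ (hval A)⟩
    rw [Fintype.sum_option]
    simp only [hqU', hm', Option.elim, mul_assoc, ← Finset.mul_sum, ← hγ]
    have := mul_le_mul_of_nonneg_left (le_abs_self γ) ht0.le
    linarith
  refine exists_memoryless_of_strict pU pV pW pD hp0 π ?_ ?_ ?_ (half_pos hε) m' ?_
  · intro x
    rw [Fintype.sum_option]
    simp only [hqU', hqV', hW', Option.elim, mul_assoc, ← Finset.mul_sum, ← Finset.sum_mul]
    rw [(hV u₀).2]
    have := hmarg x
    simp only [mul_assoc, ← Finset.mul_sum] at this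
    rw [this]
    ring
  · refine hR.imp (fun h => ?_) fun h => by rintro (_ | u) v; exacts [rfl, h u v]
    refine lt_of_eq_of_lt ?_ (scale (mul_pos h.1 hlog) h.2)
    simp only [Fintype.sum_prod_type, Fintype.sum_option]
    simp only [hqU', hqV', hW', Option.elim, log_div_self_eq_zero, mul_zero,
      Finset.sum_const_zero, zero_add, Finset.mul_sum, mul_assoc]
  · refine hR0.imp (fun h => ?_) id
    refine lt_of_eq_of_lt ?_ (scale (mul_pos h.1 hlog) h.2)
    simp only [Fintype.sum_prod_type, Fintype.sum_option]
    simp only [hqU', hqV', hW', hD', Option.elim, ← Finset.sum_mul, (hV u₀).2, one_mul,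
      log_div_self_eq_zero, mul_zero, Finset.sum_const_zero, zero_add, Finset.mul_sum, mul_assoc]
  · rintro (_ | u) z
    · have hp : IsPMF fun a : X × Y => ∑ v, qV' none v * (W' none v a.1 * D' none v a.2) := by
        have := hp0.compProd fun _ => isPMF_ite_eq y₀
        simp only [hqV', hW', hD', Option.elim, ← Finset.sum_mul, (hV u₀).2, one_mul]
        exact this
      exact (abs_le.1 (hp.abs_sum_mul_le (fun a => π a.1 a.2 z) fun a => hB _ _ _)).1
    · exact hm u z

end

/-! ### Factorizations and fixed points of causal kernels -/

/-- The sequence obtained from `ω` by replacing the letters from time `t` on by `ω₀`. -/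
def pastOf {Ω : Type} {n : ℕ} (ω₀ : Ω) (t : Fin n) (ω : Fin n → Ω) : Fin n → Ω :=
  fun m => if m < t then ω m else ω₀

theorem pastOf_apply {Ω : Type} {n : ℕ} {ω₀ : Ω} {t m : Fin n} (h : m < t) (ω : Fin n → Ω) :
    pastOf ω₀ t ω m = ω m := if_pos h

section

variable {Ω : Type} [Fintype Ω]

/-- Every nonnegative weight on sequences factors into its total mass and a causal kernel. -/
theorem exists_isCausalKernel_factorization [Nonempty Ω] {n : ℕ} (a : (Fin n → Ω) → ℝ)
    (ha : ∀ ω, 0 ≤ a ω) :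
    ∃ κ, IsCausalKernel κ ∧ ∀ ω, a ω = (∑ ω', a ω') * ∏ i, κ i ω (ω i) := by
  induction n with
  | zero =>
    refine ⟨fun i => i.elim0, ⟨fun i => i.elim0, fun i => i.elim0⟩, fun ω => ?_⟩
    simp [Subsingleton.elim ω default]
  | succ n ih =>
    choose κ hκ hfac using fun b => ih (fun ω => a (Fin.cons b ω)) fun ω => ha _
    set s : Ω → ℝ := fun b => ∑ ω : Fin n → Ω, a (Fin.cons b ω) with hs
    have hs0 : ∀ b, 0 ≤ s b := fun b => Finset.sum_nonneg fun _ _ => ha _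
    have htot : ∑ ω, a ω = ∑ b, s b := sum_fin_cons a
    obtain ⟨μ, hμ, hsμ⟩ : ∃ μ : Ω → ℝ, IsPMF μ ∧ ∀ b, s b = (∑ b, s b) * μ b := by
      by_cases h0 : ∑ b, s b = 0
      · refine ⟨_, isPMF_ite_eq (Classical.arbitrary Ω), fun b => ?_⟩
        rw [h0, zero_mul]
        exact (Finset.sum_eq_zero_iff_of_nonneg fun b _ => hs0 b).1 h0 b (Finset.mem_univ b)
      · refine ⟨fun b => s b / ∑ b, s b,
          ⟨fun b => div_nonneg (hs0 b) (Finset.sum_nonneg fun b _ => hs0 b), ?_⟩, fun b => ?_⟩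
        · rw [← Finset.sum_div, div_self h0]
        · rw [mul_div_cancel₀ _ h0]
    refine ⟨fun i ω => Fin.cases (motive := fun _ => Ω → ℝ) μ
      (fun i => κ (ω 0) i (Fin.tail ω)) i, ⟨fun i ω => ?_, fun i ω ω' h => ?_⟩, fun ω => ?_⟩
    · refine Fin.cases hμ (fun i => ?_) i
      exact (hκ _).1 _ _
    · revert h
      refine Fin.cases (fun _ => rfl) (fun i h => ?_) i
      have h0 : ω 0 = ω' 0 := h 0 (Fin.succ_pos i)
      simp only [Fin.cases_succ, h0]
      exact (hκ _).2 i _ _ fun m hm => h m.succ (Fin.succ_lt_succ_iff.2 hm)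
    · rw [htot, Fin.prod_univ_succ]
      simp only [Fin.cases_zero, Fin.cases_succ]
      rw [← mul_assoc, ← hsμ, ← Fin.cons_self_tail ω, hfac]
      simp only [Fin.cons_self_tail, Fin.cons_zero, Fin.cons_succ, hs]

/-- A strictly causal self-map of sequences has a fixed point. -/
theorem exists_eq_of_strictly_causal {Z : Type} [Nonempty Z] {n : ℕ}
    (σ : Fin n → (Fin n → Z) → Z)
    (hσ : ∀ t z z', (∀ m, m < t → z m = z' m) → σ t z = σ t z') : ∃ g, ∀ t, g t = σ t g := by
  set G : ℕ → Fin n → Z := fun s => (fun z t => σ t z)^[s] fun _ => Classical.arbitrary Z with hG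
  have hG1 : ∀ s t, G (s + 1) t = σ t (G s) := fun s t => by
    simp only [hG, Function.iterate_succ_apply']
  have key : ∀ s, ∀ t : Fin n, t.val < s → G s t = G (s + 1) t := by
    intro s
    induction s with
    | zero => intro t ht; omega
    | succ s ih =>
      intro t ht
      rw [hG1, hG1]
      exact hσ t _ _ fun m hm => ih m (by have : m.val < t.val := hm; omega)
  exact ⟨G n, fun t => by rw [key n t t.2, hG1]⟩

theorem IsCausalKernel.sum_average_eq [Nonempty Ω] {n : ℕ}
    {κ : Fin n → (Fin n → Ω) → Ω → ℝ} (h : IsCausalKernel κ)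
    (f : Fin n → (Fin n → Ω) → Ω → ℝ)
    (hf : ∀ t ω ω', (∀ m, m < t → ω m = ω' m) → f t ω = f t ω') :
    ∑ ω, (∏ i, κ i ω (ω i)) * ∑ t, ∑ a, κ t ω a * f t ω a
      = ∑ ω, (∏ i, κ i ω (ω i)) * ∑ t, f t ω (ω t) := by
  have upd : ∀ (t : Fin n) (ω : Fin n → Ω) a m, m < t → Function.update ω t a m = ω m :=
    fun t ω a m hm => Function.update_of_ne hm.ne _ _
  have hc : ∀ t ω ω', (∀ m, m ≤ t → ω m = ω' m) →
      ∑ a, κ t ω a * f t ω a = ∑ a, κ t ω' a * f t ω' a ∧ f t ω (ω t) = f t ω' (ω' t) := by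
    intro t ω ω' hm
    rw [h.2 t ω ω' fun m h => hm m h.le, hf t ω ω' fun m h => hm m h.le, hm t le_rfl]
    exact ⟨rfl, rfl⟩
  have hk : ∀ t ω a, κ t (Function.update ω t a) = κ t ω := fun t ω a => h.2 _ _ _ (upd t ω a)
  have hfu : ∀ t ω a, f t (Function.update ω t a) = f t ω := fun t ω a => hf _ _ _ (upd t ω a)
  have h1 := h.sum_nonneg (fun t ω => f t ω (ω t) - ∑ a, κ t ω a * f t ω a)
    (fun t ω ω' hm => by rw [(hc t ω ω' hm).1, (hc t ω ω' hm).2])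
    (fun t ω => by
      simp only [hk, hfu, Function.update_self, mul_sub, Finset.sum_sub_distrib]
      rw [← Finset.sum_mul, (h.1 t ω).2]; simp)
  have h2 := h.sum_nonneg (fun t ω => (∑ a, κ t ω a * f t ω a) - f t ω (ω t))
    (fun t ω ω' hm => by rw [(hc t ω ω' hm).1, (hc t ω ω' hm).2])
    (fun t ω => by
      simp only [hk, hfu, Function.update_self, mul_sub, Finset.sum_sub_distrib]
      rw [← Finset.sum_mul, (h.1 t ω).2]; simp)
  simp only [Finset.sum_sub_distrib, mul_sub] at h1 h2
  linarith

/-- The probability of a given past. -/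
theorem IsCausalKernel.sum_ite_pastOf_eq [Nonempty Ω] {n : ℕ}
    {κ : Fin n → (Fin n → Ω) → Ω → ℝ} (h : IsCausalKernel κ) (ω₀ : Ω) (t : Fin n)
    (ω' : Fin n → Ω) (hω' : pastOf ω₀ t ω' = ω') :
    (∑ ω, if pastOf ω₀ t ω = ω' then ∏ i, κ i ω (ω i) else 0)
      = ∏ i, if i < t then κ i ω' (ω' i) else 1 := by
  set κ' : Fin n → (Fin n → Ω) → Ω → ℝ := fun i ω a =>
    if i < t then (if a = ω' i then 1 else 0) else κ i ω a with hκ'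
  have hc : IsCausalKernel κ' := by
    refine ⟨fun i ω => ?_, fun i ω ω'' hm => ?_⟩
    · by_cases hi : i < t
      · simpa only [hκ', hi, if_true] using isPMF_ite_eq (ω' i)
      · simpa only [hκ', hi, if_false] using h.1 i ω
    · funext a
      simp only [hκ', h.2 i ω ω'' hm]
  have e : (∏ i, if i < t then κ i ω' (ω' i) else 1)
      = (∏ i, if i < t then κ i ω' (ω' i) else 1) * ∑ ω, ∏ i, κ' i ω (ω i) := by
    rw [hc.sum_eq_one, mul_one]
  rw [e, Finset.mul_sum]
  refine Finset.sum_congr rfl fun ω _ => ?_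
  rw [← Finset.prod_mul_distrib]
  split_ifs with hω
  · have agree : ∀ m, m < t → ω m = ω' m := fun m hm => by
      rw [← hω, pastOf_apply hm]
    refine Finset.prod_congr rfl fun i _ => ?_
    by_cases hi : i < t
    · simp only [hκ', hi, if_true, agree i hi, mul_one]
      rw [h.2 i ω ω' fun m hm => agree m (hm.trans hi)]
    · simp only [hκ', hi, if_false, one_mul]
  · obtain ⟨i, hi⟩ : ∃ i, i < t ∧ ω i ≠ ω' i := by
      by_contra! hall
      refine hω ?_
      rw [← hω']
      funext m
      by_cases hm : m < t
      · rw [pastOf_apply hm, pastOf_apply hm, hall m hm]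
      · simp only [pastOf, hm, if_false]
    refine (Finset.prod_eq_zero (Finset.mem_univ i) ?_).symm
    simp only [hκ', hi.1, hi.2, if_true, if_false, mul_zero]

theorem sum_mul_log_div_le {K : Type} [Fintype K] [Nonempty K] (b : K → ℝ) (hb : ∀ k, 0 ≤ b k) :
    ∑ k, b k * Real.log ((∑ k, b k) / b k) ≤ (∑ k, b k) * Real.log (Fintype.card K) := by
  set s := ∑ k, b k with hs
  have hs0 : 0 ≤ s := Finset.sum_nonneg fun k _ => hb k
  have hK : (0 : ℝ) < Fintype.card K := by exact_mod_cast Fintype.card_pos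
  have key : ∀ k, b k * Real.log (s / b k)
      ≤ b k * Real.log (Fintype.card K) + (s / Fintype.card K - b k) := by
    intro k
    rcases (hb k).eq_or_lt with h | h
    · rw [← h]
      have : 0 ≤ s / Fintype.card K := by positivity
      linarith
    · have hsk : 0 < s := h.trans_le (Finset.single_le_sum (fun k _ => hb k) (Finset.mem_univ k))
      have h1 := Real.log_le_sub_one_of_pos (x := s / b k / Fintype.card K) (by positivity)
      rw [Real.log_div (by positivity) hK.ne'] at h1
      have h2 := mul_le_mul_of_nonneg_left h1 h.le
      have e : b k * (s / b k / Fintype.card K - 1) = s / Fintype.card K - b k := by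
        field_simp
      linarith
  refine (Finset.sum_le_sum fun k _ => key k).trans (le_of_eq ?_)
  rw [Finset.sum_add_distrib, Finset.sum_sub_distrib, ← Finset.sum_mul, ← hs]
  simp only [Finset.sum_const, Finset.card_univ, nsmul_eq_mul]
  rw [mul_div_cancel₀ _ hK.ne']
  ring

end

/-! ### Time sharing over the past of a causal process -/

section

variable {J K Ω : Type} [Fintype Ω] {n : ℕ}

/-- The joint law of `(t, j, ω_{<t})` and `k` when `(j, k)` has weight `r j k`, the sequence `ω` is
generated by the causal kernel `κ j k`, and `t` is uniform. -/
def timeShare (r : J → K → ℝ) (κ : J → K → Fin n → (Fin n → Ω) → Ω → ℝ) (ω₀ : Ω)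
    (u : Fin n × J × (Fin n → Ω)) (k : K) : ℝ :=
  (n : ℝ)⁻¹ * ∑ ω, if pastOf ω₀ u.1 ω = u.2.2 then
    r u.2.1 k * ∏ i, κ u.2.1 k i ω (ω i) else 0

variable {r : J → K → ℝ} {κ : J → K → Fin n → (Fin n → Ω) → Ω → ℝ}

theorem timeShare_nonneg (hr : ∀ j k, 0 ≤ r j k) (hκ : ∀ j k, IsCausalKernel (κ j k)) (ω₀ : Ω)
    (u : Fin n × J × (Fin n → Ω)) (k : K) : 0 ≤ timeShare r κ ω₀ u k := by
  refine mul_nonneg (by positivity) (Finset.sum_nonneg fun ω _ => ?_)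
  split_ifs
  · exact mul_nonneg (hr _ _) ((hκ _ _).prod_nonneg ω)
  · exact le_rfl

theorem timeShare_eq [Nonempty Ω] (hκ : ∀ j k, IsCausalKernel (κ j k)) (ω₀ : Ω) (t : Fin n)
    (j : J) (ω : Fin n → Ω) (k : K) :
    timeShare r κ ω₀ (t, j, ω) k = if pastOf ω₀ t ω = ω then
      (n : ℝ)⁻¹ * (r j k * ∏ i, if i < t then κ j k i ω (ω i) else 1) else 0 := by
  split_ifs with h
  · rw [← (hκ j k).sum_ite_pastOf_eq ω₀ t ω h, Finset.mul_sum]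
    simp only [timeShare, mul_ite, mul_zero]
  · simp only [timeShare]
    refine mul_eq_zero_of_right _ (Finset.sum_eq_zero fun ω' _ => if_neg fun h' => h ?_)
    rw [← h']
    funext m
    by_cases hm : m < t <;> simp only [pastOf, hm, if_true, if_false]

variable [Fintype J] [Fintype K]

theorem sum_timeShare_mul (ω₀ : Ω) (ψ : Fin n × J × (Fin n → Ω) → K → ℝ) :
    ∑ u, ∑ k, timeShare r κ ω₀ u k * ψ u k = (n : ℝ)⁻¹ * ∑ j, ∑ k, ∑ ω,
      (r j k * ∏ i, κ j k i ω (ω i)) * ∑ t, ψ (t, j, pastOf ω₀ t ω) k := by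
  simp only [Fintype.sum_prod_type, timeShare]
  have e : ∀ t j k, ∑ ω' : Fin n → Ω, ((n : ℝ)⁻¹ * ∑ ω, if pastOf ω₀ t ω = ω' then
      r j k * ∏ i, κ j k i ω (ω i) else 0) * ψ (t, j, ω') k
      = (n : ℝ)⁻¹ * ∑ ω, (r j k * ∏ i, κ j k i ω (ω i)) * ψ (t, j, pastOf ω₀ t ω) k := by
    intro t j k
    simp_rw [Finset.mul_sum, Finset.sum_mul]
    rw [Finset.sum_comm]
    refine Finset.sum_congr rfl fun ω _ => ?_
    simp only [mul_ite, ite_mul, mul_zero, zero_mul, Finset.sum_ite_eq, Finset.mem_univ, if_true,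
      mul_assoc]
  have e' : ∀ t j, ∑ ω' : Fin n → Ω, ∑ k, ((n : ℝ)⁻¹ * ∑ ω, if pastOf ω₀ t ω = ω' then
      r j k * ∏ i, κ j k i ω (ω i) else 0) * ψ (t, j, ω') k
      = (n : ℝ)⁻¹ * ∑ k, ∑ ω, (r j k * ∏ i, κ j k i ω (ω i)) * ψ (t, j, pastOf ω₀ t ω) k := by
    intro t j
    rw [Finset.sum_comm, Finset.mul_sum]
    exact Finset.sum_congr rfl fun k _ => e t j k
  simp_rw [e', ← Finset.mul_sum]
  congr 1
  rw [Finset.sum_comm]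
  refine Finset.sum_congr rfl fun j _ => ?_
  rw [Finset.sum_comm]
  refine Finset.sum_congr rfl fun k _ => ?_
  rw [Finset.sum_comm]
  refine Finset.sum_congr rfl fun ω _ => ?_
  rw [Finset.mul_sum]

theorem sum_timeShare_mul_kernel [Nonempty Ω] (hκ : ∀ j k, IsCausalKernel (κ j k)) (ω₀ : Ω)
    (φ : Fin n × J × (Fin n → Ω) → K → Ω → ℝ)
    (hφ : ∀ t j k ω ω', (∀ m, m < t → ω m = ω' m) → φ (t, j, ω) k = φ (t, j, ω') k) :
    ∑ u, ∑ k, timeShare r κ ω₀ u k * ∑ a, κ u.2.1 k u.1 u.2.2 a * φ u k a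
      = (n : ℝ)⁻¹ * ∑ j, ∑ k, ∑ ω,
        (r j k * ∏ i, κ j k i ω (ω i)) * ∑ t, φ (t, j, ω) k (ω t) := by
  rw [sum_timeShare_mul ω₀ fun u k => ∑ a, κ u.2.1 k u.1 u.2.2 a * φ u k a]
  congr 1
  refine Finset.sum_congr rfl fun j _ => Finset.sum_congr rfl fun k _ => ?_
  simp only [mul_assoc, ← Finset.mul_sum]
  congr 1
  rw [← (hκ j k).sum_average_eq (fun t ω a => φ (t, j, ω) k a)
    (fun t ω ω' h => by funext a; rw [hφ t j k ω ω' h])]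
  refine Finset.sum_congr rfl fun ω _ => ?_
  congr 1
  refine Finset.sum_congr rfl fun t _ => Finset.sum_congr rfl fun a _ => ?_
  rw [hφ t j k (pastOf ω₀ t ω) ω fun m hm => pastOf_apply hm ω,
    (hκ j k).2 t (pastOf ω₀ t ω) ω fun m hm => pastOf_apply hm ω]

/-- The per-letter information density averages to at most the block information. -/
theorem sum_timeShare_mul_log_le [Nonempty Ω] (hr : ∀ j k, 0 ≤ r j k)
    (hκ : ∀ j k, IsCausalKernel (κ j k)) (ω₀ : Ω)
    (num den : Fin n × J × (Fin n → Ω) → K → Ω → ℝ)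
    (hnum : ∀ t j k ω ω', (∀ m, m < t → ω m = ω' m) → num (t, j, ω) k = num (t, j, ω') k)
    (hden : ∀ t j k ω ω', (∀ m, m < t → ω m = ω' m) → den (t, j, ω) k = den (t, j, ω') k)
    (c : J → K → ℝ)
    (hpos : ∀ j k ω, 0 < r j k * ∏ i, κ j k i ω (ω i) →
      (∀ t, 0 < num (t, j, ω) k (ω t) ∧ 0 < den (t, j, ω) k (ω t)) ∧
      r j k * ∏ t, num (t, j, ω) k (ω t) ≤ c j k * ∏ t, den (t, j, ω) k (ω t)) :
    ∑ u, ∑ k, timeShare r κ ω₀ u k *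
        ∑ a, κ u.2.1 k u.1 u.2.2 a * Real.log (num u k a / den u k a)
      ≤ (n : ℝ)⁻¹ * ∑ j, ∑ k, r j k * Real.log (c j k / r j k) := by
  rw [sum_timeShare_mul_kernel hκ ω₀ (fun u k a => Real.log (num u k a / den u k a))
    fun t j k ω ω' h => by rw [hnum t j k ω ω' h, hden t j k ω ω' h]]
  refine mul_le_mul_of_nonneg_left (Finset.sum_le_sum fun j _ => Finset.sum_le_sum fun k _ => ?_)
    (by positivity)
  have e : r j k * Real.log (c j k / r j k)
      = ∑ ω, (r j k * ∏ i, κ j k i ω (ω i)) * Real.log (c j k / r j k) := by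
    rw [← Finset.sum_mul, ← Finset.mul_sum, (hκ j k).sum_eq_one, mul_one]
  rw [e]
  refine Finset.sum_le_sum fun ω _ => ?_
  have h0 : 0 ≤ r j k * ∏ i, κ j k i ω (ω i) := mul_nonneg (hr j k) ((hκ j k).prod_nonneg ω)
  rcases h0.eq_or_lt with h | h
  · rw [← h, zero_mul, zero_mul]
  · obtain ⟨hp, hle⟩ := hpos j k ω h
    refine mul_le_mul_of_nonneg_left ?_ h0
    have hrp : 0 < r j k := lt_of_le_of_ne (hr j k) fun h' => by
      rw [← h', zero_mul] at h; exact lt_irrefl _ h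
    have hN : 0 < ∏ t, num (t, j, ω) k (ω t) := Finset.prod_pos fun t _ => (hp t).1
    have hD : 0 < ∏ t, den (t, j, ω) k (ω t) := Finset.prod_pos fun t _ => (hp t).2
    rw [← Real.log_prod fun t _ => (div_pos (hp t).1 (hp t).2).ne', Finset.prod_div_distrib]
    refine Real.log_le_log (div_pos hN hD) ?_
    rw [div_le_div_iff₀ hD hrp]
    linarith

/-- Replacing the mixture `∑ v, qV u v * T u v o` by another pmf in the denominator only increases
the conditional information. -/
theorem sum_mul_log_div_mixture_le {U V O : Type} [Fintype U] [Fintype V] [Fintype O]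
    {qU : U → ℝ} (hU : IsPMF qU) {qV : U → V → ℝ} (hV : ∀ u, IsPMF (qV u)) {T : U → V → O → ℝ}
    (hT : ∀ u v, IsPMF (T u v)) {e : U → O → ℝ} (he : ∀ u, IsPMF (e u))
    (hac : ∀ u v o, qU u * qV u v * T u v o ≠ 0 → e u o ≠ 0) :
    ∑ θ : (U × V) × O, qU θ.1.1 * qV θ.1.1 θ.1.2 * T θ.1.1 θ.1.2 θ.2 *
        Real.log (T θ.1.1 θ.1.2 θ.2 / ∑ v, qV θ.1.1 v * T θ.1.1 v θ.2)
      ≤ ∑ θ : (U × V) × O, qU θ.1.1 * qV θ.1.1 θ.1.2 * T θ.1.1 θ.1.2 θ.2 *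
        Real.log (T θ.1.1 θ.1.2 θ.2 / e θ.1.1 θ.2) := by
  have h0 : ∀ u v o, 0 ≤ qU u * qV u v * T u v o := fun u v o =>
    mul_nonneg (mul_nonneg (hU.1 u) ((hV u).1 v)) ((hT u v).1 o)
  set E : U → O → ℝ := fun u o => ∑ v, qV u v * T u v o with hE
  have hE0 : ∀ u o, 0 ≤ E u o := fun u o => Finset.sum_nonneg fun v _ =>
    mul_nonneg ((hV u).1 v) ((hT u v).1 o)
  have key : ∀ u v o, qU u * qV u v * T u v o * Real.log (T u v o / E u o)
      ≤ qU u * qV u v * T u v o * Real.log (T u v o / e u o)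
        + (qU u * (qV u v * T u v o * (e u o / E u o)) - qU u * qV u v * T u v o) := by
    intro u v o
    rcases (h0 u v o).eq_or_lt with h | h
    · rcases (hU.1 u).eq_or_lt with hu | hu
      · simp [← hu]
      · have : qV u v * T u v o = 0 := by
          have := h.symm
          rw [mul_assoc] at this
          exact (mul_eq_zero.1 this).resolve_left hu.ne'
        simp [← h, this]
    · have hTp : 0 < T u v o := lt_of_le_of_ne ((hT u v).1 o) (right_ne_zero_of_mul h.ne').symm
      have hVp : 0 < qV u v := lt_of_le_of_ne ((hV u).1 v)
        (right_ne_zero_of_mul (left_ne_zero_of_mul h.ne')).symm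
      have hep : 0 < e u o := lt_of_le_of_ne ((he u).1 o) (hac u v o h.ne').symm
      have hEp : 0 < E u o := (mul_pos hVp hTp).trans_le (Finset.single_le_sum
        (f := fun v => qV u v * T u v o)
        (fun v _ => mul_nonneg ((hV u).1 v) ((hT u v).1 o)) (Finset.mem_univ v))
      have h1 := mul_le_mul_of_nonneg_left
        (Real.log_le_sub_one_of_pos (div_pos hep hEp)) h.le
      rw [Real.log_div hep.ne' hEp.ne'] at h1
      rw [Real.log_div hTp.ne' hEp.ne', Real.log_div hTp.ne' hep.ne']
      linarith
  refine (Finset.sum_le_sum fun θ _ => key θ.1.1 θ.1.2 θ.2).trans ?_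
  rw [Finset.sum_add_distrib, Finset.sum_sub_distrib]
  have hone : ∑ θ : (U × V) × O, qU θ.1.1 * qV θ.1.1 θ.1.2 * T θ.1.1 θ.1.2 θ.2 = 1 :=
    ((hU.compProd hV).compProd fun t : U × V => hT t.1 t.2).2
  have hle : ∑ θ : (U × V) × O,
      qU θ.1.1 * (qV θ.1.1 θ.1.2 * T θ.1.1 θ.1.2 θ.2 * (e θ.1.1 θ.2 / E θ.1.1 θ.2)) ≤ 1 := by
    simp only [Fintype.sum_prod_type, ← Finset.mul_sum]
    rw [← hU.2]
    refine Finset.sum_le_sum fun u _ => mul_le_of_le_one_right (hU.1 u) ?_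
    rw [Finset.sum_comm, ← (he u).2]
    refine Finset.sum_le_sum fun o _ => ?_
    rw [← Finset.sum_mul]
    change E u o * (e u o / E u o) ≤ e u o
    rcases (hE0 u o).eq_or_lt with h | h
    · rw [← h, zero_mul]; exact (he u).1 o
    · rw [mul_div_cancel₀ _ h.ne']
  linarith

theorem exists_disintegration {U V : Type} [Fintype U] [Fintype V] [Nonempty V]
    (q : U → V → ℝ) (hq : ∀ u v, 0 ≤ q u v) :
    ∃ qV : U → V → ℝ, (∀ u, IsPMF (qV u)) ∧ ∀ u v, (∑ v, q u v) * qV u v = q u v := by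
  have h : ∀ u, ∃ μ : V → ℝ, IsPMF μ ∧ ∀ v, (∑ v, q u v) * μ v = q u v := by
    intro u
    by_cases h0 : ∑ v, q u v = 0
    · refine ⟨_, isPMF_ite_eq (Classical.arbitrary V), fun v => ?_⟩
      rw [h0, zero_mul]
      exact ((Finset.sum_eq_zero_iff_of_nonneg fun v _ => hq u v).1 h0 v (Finset.mem_univ v)).symm
    · refine ⟨fun v => q u v / ∑ v, q u v,
        ⟨fun v => div_nonneg (hq u v) (Finset.sum_nonneg fun v _ => hq u v), ?_⟩, fun v => ?_⟩
      · rw [← Finset.sum_div, div_self h0]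
      · rw [mul_div_cancel₀ _ h0]
  choose qV h1 h2 using h
  exact ⟨qV, h1, h2⟩

end

/-! ### A greedy causal response -/

/-- Against a causal process that reacts to the adversary, there is a deterministic causal response
which at each time minimizes the conditional expectation of `f` given the past. -/
theorem exists_greedy_response {J K Ω Z : Type} [Fintype K] [Fintype Ω] [Nonempty Ω] [Finite Z]
    [Nonempty Z] {n : ℕ} (r : J → K → ℝ)
    (κ : J → K → Fin n → (Fin n → Ω) → (Fin n → Z) → Ω → ℝ)
    (hκ : ∀ j k t ω z, IsPMF (κ j k t ω z))
    (hκc : ∀ j k t ω ω' z z', (∀ m, m < t → ω m = ω' m) → (∀ m, m < t → z m = z' m) →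
      κ j k t ω z = κ j k t ω' z')
    (f : Ω → Z → ℝ) (ω₀ : Ω) :
    ∃ g : J → (Fin n → Ω) → Fin n → Z,
      (∀ j t ω ω', (∀ m, m < t → ω m = ω' m) → ∀ m, m ≤ t → g j ω m = g j ω' m) ∧
      (∀ j k, IsCausalKernel fun t ω => κ j k t ω (g j ω)) ∧
      ∀ u z, ∑ k, timeShare r (fun j k t ω => κ j k t ω (g j ω)) ω₀ u k *
          ∑ a, κ u.2.1 k u.1 u.2.2 (g u.2.1 u.2.2) a * f a (g u.2.1 u.2.2 u.1)
        ≤ ∑ k, timeShare r (fun j k t ω => κ j k t ω (g j ω)) ω₀ u k *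
          ∑ a, κ u.2.1 k u.1 u.2.2 (g u.2.1 u.2.2) a * f a z := by
  choose am ham using fun c : Z → ℝ => Finite.exists_min c
  set cost : J → Fin n → (Fin n → Ω) → (Fin n → Z) → Z → ℝ := fun j t ω z z' =>
    ∑ k, (r j k * ∏ i, if i < t then κ j k i ω z (ω i) else 1) * ∑ a, κ j k t ω z a * f a z'
    with hcost
  have hc : ∀ j t ω ω' z z', (∀ m, m < t → ω m = ω' m) → (∀ m, m < t → z m = z' m) →
      cost j t ω z = cost j t ω' z' := by
    intro j t ω ω' z z' hω hz
    funext z''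
    refine Finset.sum_congr rfl fun k _ => ?_
    rw [hκc j k t ω ω' z z' hω hz]
    congr 2
    refine Finset.prod_congr rfl fun i _ => ?_
    split_ifs with hi
    · rw [hκc j k i ω ω' z z' (fun m hm => hω m (hm.trans hi)) fun m hm => hz m (hm.trans hi),
        hω i hi]
    · rfl
  choose g hg using fun j ω => exists_eq_of_strictly_causal (fun t z => am (cost j t ω z))
    fun t z z' h => by rw [hc j t ω ω z z' (fun _ _ => rfl) h]
  have hgc : ∀ j t ω ω', (∀ m, m < t → ω m = ω' m) → ∀ m, m ≤ t → g j ω m = g j ω' m := by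
    intro j t ω ω' h m
    induction m using WellFoundedLT.induction with
    | ind m ih =>
      intro hm
      rw [hg, hg j ω']
      exact congrArg am (hc j m ω ω' _ _ (fun i hi => h i (hi.trans_le hm))
        fun i hi => ih i hi (hi.le.trans hm))
  have hker : ∀ j k, IsCausalKernel fun t ω => κ j k t ω (g j ω) := fun j k =>
    ⟨fun t ω => hκ _ _ _ _ _, fun t ω ω' h =>
      hκc j k t ω ω' _ _ h fun m hm => hgc j t ω ω' h m hm.le⟩
  refine ⟨g, hgc, hker, ?_⟩
  rintro ⟨t, j, ω⟩ z
  simp only [timeShare_eq hker ω₀ t j ω]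
  split_ifs with h
  · simp only [mul_assoc (n : ℝ)⁻¹, ← Finset.mul_sum]
    refine mul_le_mul_of_nonneg_left ?_ (by positivity)
    have := ham (cost j t ω (g j ω)) z
    rw [← hg j ω t] at this
    exact this
  · simp

/-! ### Block information bounds -/

theorem forall_pos_of_mul_prod_pos {n : ℕ} {c : ℝ} {f : Fin n → ℝ} (hf : ∀ i, 0 ≤ f i)
    (h : 0 < c * ∏ i, f i) (i : Fin n) : 0 < f i := by
  refine lt_of_le_of_ne (hf i) fun h' => h.ne' ?_
  rw [Finset.prod_eq_zero (Finset.mem_univ i) h'.symm, mul_zero]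

section

variable {J K Ω : Type} [Fintype J] [Fintype K] [Fintype Ω] [Nonempty Ω] {n : ℕ}
  {r : J → K → ℝ} {κ : J → K → Fin n → (Fin n → Ω) → Ω → ℝ}

theorem sum_timeShare (hn : 0 < n) (hκ : ∀ j k, IsCausalKernel (κ j k)) (ω₀ : Ω) :
    ∑ u, ∑ k, timeShare r κ ω₀ u k = ∑ j, ∑ k, r j k := by
  have h := sum_timeShare_mul (r := r) (κ := κ) ω₀ fun _ _ => 1
  have hn' : (n : ℝ) ≠ 0 := by exact_mod_cast hn.ne'
  simp only [mul_one, Finset.sum_const, Finset.card_univ, Fintype.card_fin, nsmul_eq_mul] at h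
  rw [h]
  simp only [← Finset.sum_mul, ← Finset.mul_sum, (hκ _ _).sum_eq_one, mul_one]
  field_simp

/-- The information that `k` carries about the actions, given the message and the past, is at most
`n⁻¹ * log |K|`. -/
theorem exists_sum_timeShare_mul_log_le [Nonempty K] (hn : 0 < n) (hr : ∀ j k, 0 ≤ r j k)
    (hκ : ∀ j k, IsCausalKernel (κ j k)) (ω₀ : Ω) (hr1 : ∑ j, ∑ k, r j k = 1) :
    ∃ e : Fin n × J × (Fin n → Ω) → Ω → ℝ, (∀ u, IsPMF (e u)) ∧
      (∀ u k a, timeShare r κ ω₀ u k * κ u.2.1 k u.1 u.2.2 a ≠ 0 → e u a ≠ 0) ∧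
      ∑ u, ∑ k, timeShare r κ ω₀ u k *
        ∑ a, κ u.2.1 k u.1 u.2.2 a * Real.log (κ u.2.1 k u.1 u.2.2 a / e u a)
      ≤ (n : ℝ)⁻¹ * Real.log (Fintype.card K) := by
  have hP : ∀ j k ω, 0 ≤ r j k * ∏ i, κ j k i ω (ω i) := fun j k ω =>
    mul_nonneg (hr j k) ((hκ j k).prod_nonneg ω)
  choose e he hfac using fun j => exists_isCausalKernel_factorization
    (fun ω => ∑ k, r j k * ∏ i, κ j k i ω (ω i)) fun ω => Finset.sum_nonneg fun k _ => hP j k ω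
  have hmass : ∀ j, ∑ ω : Fin n → Ω, ∑ k, r j k * ∏ i, κ j k i ω (ω i) = ∑ k, r j k := by
    intro j
    rw [Finset.sum_comm]
    simp only [← Finset.mul_sum, (hκ _ _).sum_eq_one, mul_one]
  simp only [hmass] at hfac
  have hle : ∀ j k ω, r j k * ∏ i, κ j k i ω (ω i) ≤ (∑ k, r j k) * ∏ i, e j i ω (ω i) := by
    intro j k ω
    rw [← hfac]
    exact Finset.single_le_sum (f := fun k => r j k * ∏ i, κ j k i ω (ω i))
      (fun k _ => hP j k ω) (Finset.mem_univ k)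
  have hepos : ∀ j k ω, 0 < r j k * ∏ i, κ j k i ω (ω i) → ∀ i, 0 < e j i ω (ω i) :=
    fun j k ω h => forall_pos_of_mul_prod_pos (fun i => ((he j).1 i ω).1 _) (h.trans_le (hle j k ω))
  refine ⟨fun u => e u.2.1 u.1 u.2.2, fun u => (he _).1 _ _, fun u k a hne h0 => hne ?_, ?_⟩
  · have h := sum_timeShare_mul_kernel (r := r) hκ ω₀
      (fun u k a => if e u.2.1 u.1 u.2.2 a = 0 then 1 else 0)
      fun t j k ω ω' h => by funext a; simp only [(he j).2 t ω ω' h]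
    have hz : ∀ j k ω, (r j k * ∏ i, κ j k i ω (ω i)) *
        (∑ t, if e j t ω (ω t) = 0 then (1 : ℝ) else 0) = 0 := by
      intro j k ω
      rcases (hP j k ω).eq_or_lt with h | h
      · rw [← h, zero_mul]
      · rw [Finset.sum_eq_zero fun t _ => if_neg (hepos j k ω h t).ne', mul_zero]
    simp only [hz, Finset.sum_const_zero, mul_zero] at h
    have hq := timeShare_nonneg hr hκ ω₀
    have hk : ∀ (u : Fin n × J × (Fin n → Ω)) k a, 0 ≤ κ u.2.1 k u.1 u.2.2 a *
        (if e u.2.1 u.1 u.2.2 a = 0 then (1 : ℝ) else 0) := fun u k a =>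
      mul_nonneg (((hκ _ _).1 _ _).1 a) (by split_ifs <;> norm_num)
    have hk' : ∀ u k, 0 ≤ timeShare r κ ω₀ u k * ∑ a, κ u.2.1 k u.1 u.2.2 a *
        (if e u.2.1 u.1 u.2.2 a = 0 then (1 : ℝ) else 0) := fun u k =>
      mul_nonneg (hq u k) (Finset.sum_nonneg fun a _ => hk u k a)
    have h1 := (Finset.sum_eq_zero_iff_of_nonneg fun u _ =>
      Finset.sum_nonneg fun k _ => hk' u k).1 h u (Finset.mem_univ u)
    have h2 := (Finset.sum_eq_zero_iff_of_nonneg fun k _ => hk' u k).1 h1 k (Finset.mem_univ k)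
    rcases mul_eq_zero.1 h2 with h3 | h3
    · rw [h3, zero_mul]
    · have h4 := (Finset.sum_eq_zero_iff_of_nonneg fun a _ => hk u k a).1 h3 a (Finset.mem_univ a)
      rw [if_pos h0, mul_one] at h4
      rw [h4, mul_zero]
  · refine (sum_timeShare_mul_log_le hr hκ ω₀ (fun u k => κ u.2.1 k u.1 u.2.2)
      (fun u _ => e u.2.1 u.1 u.2.2) (fun t j k ω ω' h => (hκ j k).2 t ω ω' h)
      (fun t j k ω ω' h => (he j).2 t ω ω' h) (fun j _ => ∑ k, r j k) fun j k ω h =>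
      ⟨fun t => ⟨forall_pos_of_mul_prod_pos (fun i => ((hκ j k).1 i ω).1 _) h t,
        hepos j k ω h t⟩, hle j k ω⟩).trans ?_
    refine mul_le_mul_of_nonneg_left ?_ (by positivity)
    refine (Finset.sum_le_sum fun j _ => sum_mul_log_div_le (r j) (hr j)).trans ?_
    rw [← Finset.sum_mul, hr1, one_mul]

end

section

variable {X Y : Type} [Fintype X] [Fintype Y] {n : ℕ}

theorem sum_prod_mul_fst [Nonempty Y] (w : Fin n → (Fin n → X) → X → ℝ)
    {d : Fin n → (Fin n → X × Y) → Y → ℝ} (hd : ∀ t ω, IsPMF (d t ω))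
    (hdc : ∀ t ω ω', (∀ m, m < t → ω m = ω' m) → d t ω = d t ω') (F : (Fin n → X) → ℝ) :
    ∑ ω : Fin n → X × Y, (∏ i, w i (fun m => (ω m).1) (ω i).1 * d i ω (ω i).2) *
      F (fun m => (ω m).1) = ∑ x, (∏ i, w i x (x i)) * F x := by
  refine (sum_arrow_prod fun x y => (∏ i, w i x (x i) * d i (fun m => (x m, y m)) (y i)) *
    F x).symm.trans (Finset.sum_congr rfl fun x _ => ?_)
  have h : IsCausalKernel fun t (y : Fin n → Y) => d t fun m => (x m, y m) :=
    ⟨fun t y => hd _ _, fun t y y' hy => hdc _ _ _ fun m hm => by rw [hy m hm]⟩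
  simp only [Finset.prod_mul_distrib, mul_right_comm, ← Finset.mul_sum]
  rw [h.sum_eq_one, mul_one]

theorem IsCausalKernel.mul_snd {w : Fin n → (Fin n → X) → X → ℝ} (hw : IsCausalKernel w)
    {d : Fin n → (Fin n → X × Y) → Y → ℝ} (hd : ∀ t ω, IsPMF (d t ω))
    (hdc : ∀ t ω ω', (∀ m, m < t → ω m = ω' m) → d t ω = d t ω') :
    IsCausalKernel fun t (ω : Fin n → X × Y) (b : X × Y) =>
      w t (fun m => (ω m).1) b.1 * d t ω b.2 := by
  refine ⟨fun t ω => ⟨fun b => mul_nonneg ((hw.1 _ _).1 _) ((hd _ _).1 _), ?_⟩,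
    fun t ω ω' h => ?_⟩
  · rw [Fintype.sum_prod_type]
    simp_rw [← Finset.mul_sum, (hd _ _).2, mul_one, (hw.1 _ _).2]
  · dsimp only
    rw [hdc t ω ω' h, hw.2 t _ (fun m => (ω' m).1) fun m hm => by rw [h m hm]]

variable {J K : Type} [Fintype J] [Fintype K] {r : J → K → ℝ}
  {w : J → K → Fin n → (Fin n → X) → X → ℝ} {d : J → K → Fin n → (Fin n → X × Y) → Y → ℝ}
  {p0 : X → ℝ}

/-- The information that the message, the key and the past carry about the next source letter is at
most `n⁻¹ * log |J|`. -/
theorem sum_timeShare_mul_log_source_le [Nonempty X] [Nonempty Y] [Nonempty J] (hp0 : IsPMF p0)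
    (hr : ∀ j k, 0 ≤ r j k) (hw : ∀ j k, IsCausalKernel (w j k))
    (hd : ∀ j k t ω, IsPMF (d j k t ω))
    (hdc : ∀ j k t ω ω', (∀ m, m < t → ω m = ω' m) → d j k t ω = d j k t ω') (ω₀ : X × Y)
    (hr1 : ∑ j, ∑ k, r j k = 1)
    (hle : ∀ j k x, r j k * ∏ i, w j k i x (x i) ≤ (∑ j, r j k) * ∏ i, p0 (x i)) :
    ∑ u, ∑ k, timeShare r (fun j k t ω b => w j k t (fun m => (ω m).1) b.1 * d j k t ω b.2) ω₀ u k *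
        ∑ a : X × Y, (w u.2.1 k u.1 (fun m => (u.2.2 m).1) a.1 * d u.2.1 k u.1 u.2.2 a.2) *
          Real.log (w u.2.1 k u.1 (fun m => (u.2.2 m).1) a.1 / p0 a.1)
      ≤ (n : ℝ)⁻¹ * Real.log (Fintype.card J) := by
  have hκ := fun j k => (hw j k).mul_snd (hd j k) (hdc j k)
  refine (sum_timeShare_mul_log_le hr hκ ω₀
    (fun u k a => w u.2.1 k u.1 (fun m => (u.2.2 m).1) a.1) (fun _ _ a => p0 a.1)
    (fun t j k ω ω' h => by
      dsimp only
      rw [(hw j k).2 t _ (fun m => (ω' m).1) fun m hm => by rw [h m hm]])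
    (fun _ _ _ _ _ _ => rfl) (fun _ k => ∑ j, r j k) fun j k ω h => ?_).trans ?_
  · have hwp : ∀ t, 0 < w j k t (fun m => (ω m).1) (ω t).1 := fun t =>
      pos_of_mul_pos_left (forall_pos_of_mul_prod_pos (fun i => ((hκ j k).1 i ω).1 _) h t)
        ((hd _ _ _ _).1 _)
    have hrp : 0 < r j k := pos_of_mul_pos_left h ((hκ j k).prod_nonneg ω)
    have hl := hle j k fun m => (ω m).1
    have := (mul_pos hrp (Finset.prod_pos fun t _ => hwp t)).trans_le hl
    exact ⟨fun t => ⟨hwp t, forall_pos_of_mul_prod_pos (fun i => hp0.1 _) this t⟩, hl⟩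
  · refine mul_le_mul_of_nonneg_left ?_ (by positivity)
    rw [Finset.sum_comm]
    refine (Finset.sum_le_sum fun k _ =>
      sum_mul_log_div_le (fun j => r j k) fun j => hr j k).trans ?_
    rw [← Finset.sum_mul, Finset.sum_comm, hr1, one_mul]

end

/-! ### Single-letterization of a coordination scheme -/

section

variable {X Y Z : Type} [Fintype X] [Fintype Y] [Fintype Z]

theorem exists_source_factorization [Nonempty X] {R0 R : ℝ} {n : ℕ} {p0 : X → ℝ} (hp0 : IsPMF p0)
    (S : Scheme X Y Z R0 R n) :
    ∃ (r : Fin (msgCard R n) → Fin (keyCard R0 n) → ℝ)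
      (w : Fin (msgCard R n) → Fin (keyCard R0 n) → Fin n → (Fin n → X) → X → ℝ),
      (∀ j k, 0 ≤ r j k) ∧ (∀ j k, IsCausalKernel (w j k)) ∧
      (∀ j k x, (∏ i, p0 (x i)) * (keyCard R0 n : ℝ)⁻¹ * S.enc x k j
        = r j k * ∏ i, w j k i x (x i)) ∧
      (∀ k, ∑ j, r j k = (keyCard R0 n : ℝ)⁻¹) ∧ (R = 0 → ∀ j k t x, w j k t x = p0) := by
  have ha : ∀ j k x, 0 ≤ (∏ i, p0 (x i)) * (keyCard R0 n : ℝ)⁻¹ * S.enc x k j := fun j k x =>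
    mul_nonneg (mul_nonneg (Finset.prod_nonneg fun i _ => hp0.1 _) (by positivity))
      ((S.enc_pmf _ _).1 _)
  have hc : IsCausalKernel fun (_ : Fin n) (_ : Fin n → X) => p0 :=
    ⟨fun _ _ => hp0, fun _ _ _ _ => rfl⟩
  have hfac : ∃ w : Fin (msgCard R n) → Fin (keyCard R0 n) → Fin n → (Fin n → X) → X → ℝ,
      (∀ j k, IsCausalKernel (w j k)) ∧
      (∀ j k x, (∏ i, p0 (x i)) * (keyCard R0 n : ℝ)⁻¹ * S.enc x k j
        = (∑ x : Fin n → X, (∏ i, p0 (x i)) * (keyCard R0 n : ℝ)⁻¹ * S.enc x k j)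
          * ∏ i, w j k i x (x i)) ∧ (R = 0 → ∀ j k t x, w j k t x = p0) := by
    by_cases hR : R = 0
    · refine ⟨fun _ _ _ _ => p0, fun _ _ => hc, fun j k x => ?_, fun _ _ _ _ _ => rfl⟩
      have : Subsingleton (Fin (msgCard R n)) := by
        rw [Fin.subsingleton_iff_le_one, msgCard, hR]
        simp
      have he : ∀ x, S.enc x k j = 1 := fun x => by
        have := (S.enc_pmf x k).2
        rwa [Fintype.sum_subsingleton _ j] at this
      simp only [he, mul_one, ← Finset.sum_mul]
      rw [hc.sum_eq_one, one_mul, mul_comm]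
    · choose w hw hfac using fun j k => exists_isCausalKernel_factorization _ (ha j k)
      exact ⟨w, hw, hfac, fun h => absurd h hR⟩
  obtain ⟨w, hw, hfac, h0⟩ := hfac
  refine ⟨_, w, fun j k => Finset.sum_nonneg fun x _ => ha j k x, hw, hfac, fun k => ?_, h0⟩
  rw [Finset.sum_comm]
  simp only [← Finset.mul_sum, (S.enc_pmf _ _).2, mul_one, ← Finset.sum_mul]
  rw [hc.sum_eq_one, one_mul]

/-- The adversary that plays the deterministic causal response `g`. -/
def responseAdversary {R : ℝ} {n : ℕ} (g : Fin (msgCard R n) → (Fin n → X × Y) → Fin n → Z)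
    (hg : ∀ j t ω ω', (∀ m, m < t → ω m = ω' m) → g j ω t = g j ω' t) :
    Adversary X Y Z R n where
  adv t j x y _ z := if z = g j (fun m => (x m, y m)) t then 1 else 0
  adv_pmf _ _ _ _ _ := isPMF_ite_eq _
  adv_causal t j x y z x' y' z' hx hy _ := by
    rw [hg j t (fun m => (x m, y m)) (fun m => (x' m, y' m)) fun m hm => by rw [hx m hm, hy m hm]]

theorem avgValue_responseAdversary {R0 R : ℝ} {n : ℕ} (p0 : X → ℝ) (π : X → Y → Z → ℝ)
    (S : Scheme X Y Z R0 R n) (g : Fin (msgCard R n) → (Fin n → X × Y) → Fin n → Z)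
    (hg : ∀ j t ω ω', (∀ m, m < t → ω m = ω' m) → g j ω t = g j ω' t) :
    avgValue p0 π S (responseAdversary g hg) = (n : ℝ)⁻¹ * ∑ j, ∑ k, ∑ ω : Fin n → X × Y,
      ((∏ i, p0 (ω i).1) * (keyCard R0 n : ℝ)⁻¹ * S.enc (fun m => (ω m).1) k j *
        ∏ i, S.dec i j k (fun m => (ω m).1) (fun m => (ω m).2) (g j ω) (ω i).2) *
      ∑ t, π (ω t).1 (ω t).2 (g j ω t) := by
  have hz : ∀ j k (x : Fin n → X) (y : Fin n → Y), (∑ z : Fin n → Z, (∏ i, S.dec i j k x y z (y i) *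
      (responseAdversary g hg).adv i j x y z (z i)) * ((n : ℝ)⁻¹ * ∑ i, π (x i) (y i) (z i)))
      = (∏ i, S.dec i j k x y (g j fun m => (x m, y m)) (y i)) *
        ((n : ℝ)⁻¹ * ∑ i, π (x i) (y i) (g j (fun m => (x m, y m)) i)) := by
    intro j k x y
    rw [Finset.sum_eq_single (g j fun m => (x m, y m))]
    · simp [responseAdversary]
    · intro z _ hne
      obtain ⟨i, hi⟩ := Function.ne_iff.1 hne
      rw [Finset.prod_eq_zero (Finset.mem_univ i), zero_mul]
      simp [responseAdversary, hi]
    · exact fun h => absurd (Finset.mem_univ _) h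
  rw [avgValue_eq]
  simp only [hz]
  have hxy : ∀ j k, (∑ ω : Fin n → X × Y,
      ((∏ i, p0 (ω i).1) * (keyCard R0 n : ℝ)⁻¹ * S.enc (fun m => (ω m).1) k j *
        ∏ i, S.dec i j k (fun m => (ω m).1) (fun m => (ω m).2) (g j ω) (ω i).2) *
      ∑ t, π (ω t).1 (ω t).2 (g j ω t)) = ∑ x : Fin n → X, ∑ y : Fin n → Y,
      ((∏ i, p0 (x i)) * (keyCard R0 n : ℝ)⁻¹ * S.enc x k j *
        ∏ i, S.dec i j k x y (g j fun m => (x m, y m)) (y i)) *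
      ∑ t, π (x t) (y t) (g j (fun m => (x m, y m)) t) := fun j k =>
    (sum_arrow_prod fun x y => ((∏ i, p0 (x i)) * (keyCard R0 n : ℝ)⁻¹ * S.enc x k j *
        ∏ i, S.dec i j k x y (g j fun m => (x m, y m)) (y i)) *
      ∑ t, π (x t) (y t) (g j (fun m => (x m, y m)) t)).symm
  simp only [hxy]
  rw [Finset.sum_comm]
  simp only [Finset.mul_sum]
  rw [Finset.sum_congr rfl fun k _ => Finset.sum_comm, Finset.sum_comm]
  refine Finset.sum_congr rfl fun j _ => Finset.sum_congr rfl fun k _ =>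
    Finset.sum_congr rfl fun x _ => Finset.sum_congr rfl fun y _ =>
    Finset.sum_congr rfl fun t _ => by ring

end

theorem inv_mul_log_msgCard_le {R : ℝ} (hR : 0 ≤ R) {n : ℕ} (hn : 0 < n) :
    (n : ℝ)⁻¹ * Real.log (msgCard R n) ≤ R * Real.log 2 := by
  have hn' : (0 : ℝ) < n := by exact_mod_cast hn
  rw [inv_mul_le_iff₀ hn']
  exact (Real.log_le_iff_le_exp (by exact_mod_cast msgCard_pos R n)).2 (msgCard_le_rpow hR n)

/-- The memoryless schemes do at least as well as any given scheme, up to `ε`. -/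
theorem exists_memoryless_of_scheme {X Y Z : Type} [Fintype X] [Fintype Y] [Fintype Z]
    [Nonempty X] [Nonempty Y] [Nonempty Z] {p0 : X → ℝ} (hp0 : IsPMF p0) (π : X → Y → Z → ℝ)
    {R0 R : ℝ} (hR0 : 0 ≤ R0) (hR : 0 ≤ R) {n : ℕ} (hn : 0 < n) (S : Scheme X Y Z R0 R n)
    {ε : ℝ} (hε : 0 < ε) :
    ∃ (N : ℕ) (_ : 0 < N) (S' : Scheme X Y Z R0 R N), MemorylessDecoder S' ∧
      ∀ A', (⨅ A, avgValue p0 π S A) - ε ≤ avgValue p0 π S' A' := by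
  obtain ⟨r, w, hr, hw, hfac, hrk, hw0⟩ := exists_source_factorization hp0 S
  have hL : (keyCard R0 n : ℝ) ≠ 0 := by exact_mod_cast (keyCard_pos R0 n).ne'
  have hr1 : ∑ j, ∑ k, r j k = 1 := by
    rw [Finset.sum_comm]
    simp [hrk, hL]
  have ω₀ : X × Y := Classical.arbitrary _
  obtain ⟨g, hg, hκ, hgreedy⟩ := exists_greedy_response r
    (fun j k t (ω : Fin n → X × Y) z b => w j k t (fun m => (ω m).1) b.1 *
      S.dec t j k (fun m => (ω m).1) (fun m => (ω m).2) z b.2)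
    (fun j k t ω z => ⟨fun b => mul_nonneg (((hw j k).1 _ _).1 _) ((S.dec_pmf _ _ _ _ _ _).1 _), by
      rw [Fintype.sum_prod_type]
      simp_rw [← Finset.mul_sum, (S.dec_pmf _ _ _ _ _ _).2, mul_one, ((hw j k).1 _ _).2]⟩)
    (fun j k t ω ω' z z' hω hz => by
      rw [(hw j k).2 t _ (fun m => (ω' m).1) fun m hm => by rw [hω m hm],
        S.dec_causal t j k _ _ _ (fun m => (ω' m).1) (fun m => (ω' m).2) z'
          (fun m hm => by rw [hω m hm]) (fun m hm => by rw [hω m hm]) hz])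
    (fun b z => π b.1 b.2 z) ω₀
  set d : Fin (msgCard R n) → Fin (keyCard R0 n) → Fin n → (Fin n → X × Y) → Y → ℝ :=
    fun j k t ω => S.dec t j k (fun m => (ω m).1) (fun m => (ω m).2) (g j ω)
  have hd : ∀ j k t ω, IsPMF (d j k t ω) := fun j k t ω => S.dec_pmf _ _ _ _ _ _
  have hdc : ∀ j k t ω ω', (∀ m, m < t → ω m = ω' m) → d j k t ω = d j k t ω' :=
    fun j k t ω ω' h => S.dec_causal t j k _ _ _ _ _ _ (fun m hm => by rw [h m hm])
      (fun m hm => by rw [h m hm]) fun m hm => hg j t ω ω' h m hm.le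
  set κ : Fin (msgCard R n) → Fin (keyCard R0 n) → Fin n → (Fin n → X × Y) → X × Y → ℝ :=
    fun j k t ω b => w j k t (fun m => (ω m).1) b.1 * d j k t ω b.2
  replace hκ : ∀ j k, IsCausalKernel (κ j k) := hκ
  set q := timeShare r κ ω₀
  have hq : ∀ u k, 0 ≤ q u k := timeShare_nonneg hr hκ ω₀
  obtain ⟨qV, hV, hqV⟩ := exists_disintegration q hq
  have hU : IsPMF fun u => ∑ k, q u k :=
    ⟨fun u => Finset.sum_nonneg fun k _ => hq u k, by rw [sum_timeShare hn hκ, hr1]⟩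
  have hκpmf : ∀ (u : Fin n × Fin (msgCard R n) × (Fin n → X × Y)) k,
      IsPMF (κ u.2.1 k u.1 u.2.2) := fun u k => (hκ _ _).1 _ _
  have hmarg : ∀ x, ∑ u, ∑ k, q u k * w u.2.1 k u.1 (fun m => (u.2.2 m).1) x = p0 x := by
    intro x
    have hsum : ∀ x : Fin n → X, ∑ j, ∑ k, r j k * ∏ i, w j k i x (x i) = ∏ i, p0 (x i) := by
      intro x
      simp only [← hfac]
      rw [Finset.sum_comm]
      simp only [← Finset.mul_sum, (S.enc_pmf _ _).2, mul_one, Finset.sum_const, Finset.card_univ,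
        Fintype.card_fin, nsmul_eq_mul]
      field_simp
    have hind : ∀ (u : Fin n × Fin (msgCard R n) × (Fin n → X × Y)) k,
        ∑ a : X × Y, κ u.2.1 k u.1 u.2.2 a * (if a.1 = x then 1 else 0)
        = w u.2.1 k u.1 (fun m => (u.2.2 m).1) x := by
      intro u k
      simp [κ, Fintype.sum_prod_type, ← Finset.mul_sum, (hd _ _ _ _).2]
    have h := sum_timeShare_mul_kernel (r := r) hκ ω₀
      (fun _ _ a => if a.1 = x then (1 : ℝ) else 0) fun _ _ _ _ _ _ => rfl
    simp only [hind] at h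
    rw [h]
    have hfst : ∀ j k, ∑ ω : Fin n → X × Y, (r j k * ∏ i, κ j k i ω (ω i)) *
        (∑ t, if (ω t).1 = x then (1 : ℝ) else 0)
        = ∑ x' : Fin n → X, (r j k * ∏ i, w j k i x' (x' i)) *
          (∑ t, if x' t = x then (1 : ℝ) else 0) := fun j k => by
      simp only [mul_assoc, ← Finset.mul_sum]
      congr 1
      exact sum_prod_mul_fst (w j k) (hd j k) (hdc j k)
        fun x' => ∑ t, if x' t = x then (1 : ℝ) else 0
    have hswap : ∑ j, ∑ k, ∑ x' : Fin n → X, (r j k * ∏ i, w j k i x' (x' i)) *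
          (∑ t, if x' t = x then (1 : ℝ) else 0)
        = ∑ x' : Fin n → X, (∏ i, p0 (x' i)) * ∑ t, if x' t = x then (1 : ℝ) else 0 := by
      simp only [← hsum, Finset.sum_mul]
      rw [Finset.sum_congr rfl fun j _ => Finset.sum_comm, Finset.sum_comm]
    simp only [hfst, hswap]
    simp_rw [Finset.mul_sum (s := (Finset.univ : Finset (Fin n)))]
    rw [Finset.sum_comm]
    simp only [sum_pi_mul_apply (fun _ => hp0) _ fun a => if a = x then (1 : ℝ) else 0]
    have hn' : (n : ℝ) ≠ 0 := by exact_mod_cast hn.ne'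
    simp [hn']
  have hI1 : ∑ u, ∑ k, q u k * ∑ a : X × Y,
      (w u.2.1 k u.1 (fun m => (u.2.2 m).1) a.1 * d u.2.1 k u.1 u.2.2 a.2) *
      Real.log (w u.2.1 k u.1 (fun m => (u.2.2 m).1) a.1 / p0 a.1) ≤ R * Real.log 2 := by
    refine (sum_timeShare_mul_log_source_le hp0 hr hw hd hdc ω₀ hr1 fun j k x => ?_).trans ?_
    · rw [← hfac, hrk, mul_comm (keyCard R0 n : ℝ)⁻¹]
      exact mul_le_of_le_one_right (mul_nonneg (Finset.prod_nonneg fun i _ => hp0.1 _)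
        (by positivity)) ((S.enc_pmf _ _).le_one _)
    · rw [Fintype.card_fin]
      exact inv_mul_log_msgCard_le hR hn
  obtain ⟨e, he, hac, hI2⟩ := exists_sum_timeShare_mul_log_le hn hr hκ ω₀ hr1
  have hval : (⨅ A, avgValue p0 π S A) ≤ ∑ u, ∑ k, q u k *
      ∑ a : X × Y, κ u.2.1 k u.1 u.2.2 a * π a.1 a.2 (g u.2.1 u.2.2 u.1) := by
    obtain ⟨B, hB0, hB⟩ := exists_abs_payoff_le π
    refine (ciInf_le ⟨-B, ?_⟩ (responseAdversary g fun j t ω ω' h => hg j t ω ω' h t le_rfl)).trans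
      (le_of_eq ?_)
    · rintro _ ⟨A, rfl⟩
      exact (abs_le.1 (abs_avgValue_le hp0 hB0 hB S A)).1
    · rw [avgValue_responseAdversary, sum_timeShare_mul_kernel hκ ω₀
        (fun u k a => π a.1 a.2 (g u.2.1 u.2.2 u.1))
        fun t j k ω ω' h => by simp only [hg j t ω ω' h t le_rfl]]
      simp only [hfac, κ, d, Finset.prod_mul_distrib, mul_assoc]
  have hm : ∀ u z, (∑ k, q u k) * ∑ a : X × Y, (∑ k, qV u k *
      (w u.2.1 k u.1 (fun m => (u.2.2 m).1) a.1 * d u.2.1 k u.1 u.2.2 a.2)) * π a.1 a.2 z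
      = ∑ k, q u k * ∑ a : X × Y, κ u.2.1 k u.1 u.2.2 a * π a.1 a.2 z := by
    intro u z
    simp only [Finset.sum_mul (s := (Finset.univ : Finset (Fin (keyCard R0 n))))]
    rw [Finset.sum_comm, ← Finset.sum_mul, Finset.mul_sum]
    refine Finset.sum_congr rfl fun k _ => ?_
    rw [← hqV u k, mul_assoc]
    congr 1
    rw [Finset.mul_sum]
    exact Finset.sum_congr rfl fun a _ => mul_assoc _ _ _
  choose zm hzm using fun u : Fin n × Fin (msgCard R n) × (Fin n → X × Y) => Finite.exists_min
    fun z => ∑ a : X × Y, (∑ k, qV u k *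
      (w u.2.1 k u.1 (fun m => (u.2.2 m).1) a.1 * d u.2.1 k u.1 u.2.2 a.2)) * π a.1 a.2 z
  have hRate : (0 < R ∧ ∑ θ : ((Fin n × Fin (msgCard R n) × (Fin n → X × Y)) ×
      Fin (keyCard R0 n)) × X, (∑ k, q θ.1.1 k) * qV θ.1.1 θ.1.2 *
        w θ.1.1.2.1 θ.1.2 θ.1.1.1 (fun m => (θ.1.1.2.2 m).1) θ.2 *
        Real.log (w θ.1.1.2.1 θ.1.2 θ.1.1.1 (fun m => (θ.1.1.2.2 m).1) θ.2 / p0 θ.2)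
        ≤ R * Real.log 2) ∨ ∀ (u : Fin n × Fin (msgCard R n) × (Fin n → X × Y)) k,
          w u.2.1 k u.1 (fun m => (u.2.2 m).1) = p0 := by
    rcases hR.eq_or_lt with h | h
    · exact Or.inr fun u k => hw0 h.symm _ _ _ _
    · refine Or.inl ⟨h, le_trans (le_of_eq ?_) hI1⟩
      simp only [hqV]
      rw [Fintype.sum_prod_type, Fintype.sum_prod_type]
      refine Finset.sum_congr rfl fun u _ => Finset.sum_congr rfl fun k _ => ?_
      rw [Fintype.sum_prod_type, Finset.mul_sum]
      refine Finset.sum_congr rfl fun a _ => ?_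
      simp only [mul_right_comm _ (d _ _ _ _ _), ← Finset.mul_sum, (hd _ _ _ _).2, mul_one,
        mul_assoc]
  have hKey : (0 < R0 ∧ ∑ θ : ((Fin n × Fin (msgCard R n) × (Fin n → X × Y)) ×
      Fin (keyCard R0 n)) × (X × Y), (∑ k, q θ.1.1 k) * qV θ.1.1 θ.1.2 *
        κ θ.1.1.2.1 θ.1.2 θ.1.1.1 θ.1.1.2.2 θ.2 *
        Real.log (κ θ.1.1.2.1 θ.1.2 θ.1.1.1 θ.1.1.2.2 θ.2 /
          ∑ k, qV θ.1.1 k * κ θ.1.1.2.1 k θ.1.1.1 θ.1.1.2.2 θ.2)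
        ≤ R0 * Real.log 2) ∨ Subsingleton (Fin (keyCard R0 n)) := by
    rcases hR0.eq_or_lt with h | h
    · right
      rw [Fin.subsingleton_iff_le_one, keyCard, ← h]
      simp
    · refine Or.inl ⟨h, (sum_mul_log_div_mixture_le hU hV hκpmf he fun u k a => ?_).trans
        (le_trans (le_of_eq ?_) (hI2.trans ?_))⟩
      · rw [hqV]; exact hac u k a
      · simp only [hqV]
        rw [Fintype.sum_prod_type, Fintype.sum_prod_type]
        refine Finset.sum_congr rfl fun u _ => Finset.sum_congr rfl fun k _ => ?_
        rw [Finset.mul_sum]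
        exact Finset.sum_congr rfl fun a _ => mul_assoc _ _ _
      · rw [Fintype.card_fin]
        exact inv_mul_log_msgCard_le hR0 hn
  obtain ⟨N, hN, S', hS', hS'v⟩ := exists_memoryless_of_le hU hV
    (W := fun u k => w u.2.1 k u.1 fun m => (u.2.2 m).1) (fun u k => (hw _ _).1 _ _)
    (D := fun u k => d u.2.1 k u.1 u.2.2) (fun u k => hd _ _ _ _) hp0 π
    (fun x => by simpa only [hqV] using hmarg x) hRate hKey hε _ hzm
  refine ⟨N, hN, S', hS', fun A => le_trans (sub_le_sub_right (hval.trans ?_) ε) (hS'v A)⟩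
  exact Finset.sum_le_sum fun u _ => (hgreedy u (zm u)).trans (hm u (zm u)).ge

/-- **Memoryless decoders suffice.**  Restricting the decoder at Node B to conditional pmfs
of the form `{p(yᵢ | j, k)}` does not decrease the robust achievable value against fully
informed adversaries. -/
theorem memoryless_decoders_suffice
    {X Y Z : Type} [Fintype X] [Fintype Y] [Fintype Z]
    [Nonempty X] [Nonempty Y] [Nonempty Z]
    (p0 : X → ℝ) (hp0 : IsPMF p0) (π : X → Y → Z → ℝ)
    (R0 R : ℝ) (hR0 : 0 ≤ R0) (hR : 0 ≤ R) :
    (⨆ (n : ℕ) (_ : 0 < n) (S : Scheme X Y Z R0 R n) (_ : MemorylessDecoder S),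
        ⨅ A : Adversary X Y Z R n, avgValue p0 π S A)
      = robustValue p0 π R0 R :=
  iSup_memoryless_eq_robustValue hp0 π R0 R fun _ hn S _ hε =>
    exists_memoryless_of_scheme hp0 π hR0 hR hn S hε

end
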